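/- arXiv:math/0304272 — 3 statements merged into one kernel-verified Lean document; each statement's English description precedes it below -/
import Mathlib

section
/- Let p_1, …, p_k be distinct primes, let m_1, …, m_k be integers with m_i ≥ 2, and assume p_i does not divide m_i for each i = 1, …, k. Let a_1, …, a_k be integers with 0 ≤ a_i ≤ m_i − 1. Set m := max{m_i : 1 ≤ i ≤ k}, p := max{p_i : 1 ≤ i ≤ k}, and δ := 1/(120 k² p^{3m} m²). Then there exists a constant C > 0 such that for every positive integer N, | #{0 ≤ n < N : e_{p_i}(n) ≡ a_i (mod m_i) for all 1 ≤ i ≤ k} − N/(m_1 ⋯ m_k) | ≤ C · N^{1−δ}. -/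
/-- For a prime `p`, `e_p(n)` is the exponent of `p` in the factorization of `n!`. -/
def factorialExp (p n : ℕ) : ℕ := (Nat.factorial n).factorization p

section
open Finset

lemma xs_block {β : Type*} [AddCommMonoid β] (p K : ℕ) (f : ℕ → β) :
    ∑ n ∈ range (p * K), f n = ∑ k ∈ range K, ∑ c ∈ range p, f (c + p * k) := by
  induction K with
  | zero => simp
  | succ K ih =>
    rw [Nat.mul_succ, sum_range_add, ih, sum_range_succ]
    congr 1
    exact sum_congr rfl fun x _ => by rw [add_comm]

noncomputable def xG (p : ℕ) (ζ : ℂ) : ℂ → ℕ → ℕ → ℂ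
  | _, 0, _ => 1
  | Z, l + 1, n => Z ^ (n % p) * xG p ζ (Z ^ p * ζ) l (n / p)

lemma xG_norm (p : ℕ) (ζ : ℂ) (hζ : ‖ζ‖ = 1) (l : ℕ) :
    ∀ (Z : ℂ) (n : ℕ), ‖Z‖ = 1 → ‖xG p ζ Z l n‖ = 1 := by
  induction l with
  | zero => intro Z n _; simp [xG]
  | succ l ih =>
    intro Z n hZ
    rw [xG, norm_mul, norm_pow, hZ, one_pow, one_mul]
    apply ih
    simp [hZ, hζ]

lemma xG_mod (p : ℕ) (hp : 0 < p) (ζ : ℂ) (l : ℕ) :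
    ∀ (Z : ℂ) (n : ℕ), xG p ζ Z l (n % p ^ l) = xG p ζ Z l n := by
  induction l with
  | zero => intro Z n; simp [xG]
  | succ l ih =>
    intro Z n
    rw [xG, xG, ← ih _ (n / p)]
    congr 2
    · rw [pow_succ, mul_comm]; exact Nat.mod_mul_right_mod n p (p ^ l)
    · rw [pow_succ, mul_comm, Nat.mod_mul_right_div_self]

noncomputable def xC (p : ℕ) (ζ : ℂ) (Z : ℂ) (l r : ℕ) : ℂ :=
  (∑ n ∈ range (p ^ l), xG p ζ Z l (n + r) * star (xG p ζ Z l n)) / (p : ℂ) ^ l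

lemma unit_star {Z : ℂ} (hZ : ‖Z‖ = 1) : Z * star Z = 1 := by
  have := Complex.mul_conj Z
  rw [Complex.normSq_eq_norm_sq, hZ] at this
  simpa using this

lemma xC_zero (p : ℕ) (hp : 0 < p) (ζ : ℂ) (hζ : ‖ζ‖ = 1) (Z : ℂ) (hZ : ‖Z‖ = 1) (l : ℕ) :
    xC p ζ Z l 0 = 1 := by
  unfold xC
  have : ∀ n ∈ range (p ^ l), xG p ζ Z l (n + 0) * star (xG p ζ Z l n) = 1 := fun n _ =>
    unit_star (xG_norm p ζ hζ l Z n hZ)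
  rw [sum_congr rfl this]
  have : (p : ℂ) ≠ 0 := by exact_mod_cast hp.ne'
  simp [this]

lemma xC_le (p : ℕ) (hp : 0 < p) (ζ : ℂ) (hζ : ‖ζ‖ = 1) (Z : ℂ) (hZ : ‖Z‖ = 1) (l r : ℕ) :
    ‖xC p ζ Z l r‖ ≤ 1 := by
  unfold xC
  have hp' : (0 : ℝ) < (p : ℝ) ^ l := by positivity
  rw [norm_div, norm_pow, Complex.norm_natCast, div_le_one hp']
  refine (norm_sum_le _ _).trans ?_
  simp [xG_norm p ζ hζ l Z _ hZ]

lemma xC_rec (p : ℕ) (hp : 0 < p) (ζ : ℂ) (Z : ℂ) (hZ : ‖Z‖ = 1) (l d r : ℕ)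
    (hd : d < p) :
    xC p ζ Z (l + 1) (d + p * r) = Z ^ d * ((1 - (d : ℂ) / p) * xC p ζ (Z ^ p * ζ) l r
      + (d : ℂ) / p * (star Z ^ p * xC p ζ (Z ^ p * ζ) l (r + 1))) := by
  have hpc : (p : ℂ) ≠ 0 := by exact_mod_cast hp.ne'
  have hu := unit_star hZ
  have huk : ∀ k : ℕ, Z ^ k * star Z ^ k = 1 := fun k => by rw [← mul_pow, hu, one_pow]
  unfold xC
  rw [pow_succ, mul_comm (p ^ l) p, xs_block]
  have key : ∀ k ∈ range (p ^ l), ∑ c ∈ range p, xG p ζ Z (l + 1) (c + p * k + (d + p * r)) *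
      star (xG p ζ Z (l + 1) (c + p * k)) =
      Z ^ d * (((p - d : ℕ) : ℂ) * (xG p ζ (Z ^ p * ζ) l (k + r) * star (xG p ζ (Z ^ p * ζ) l k))
       + d * (star Z ^ p * (xG p ζ (Z ^ p * ζ) l (k + (r + 1)) * star (xG p ζ (Z ^ p * ζ) l k)))) := by
    intro k _
    have hpd : range p = range ((p - d) + d) := by congr 1; omega
    rw [hpd, sum_range_add]
    have h1 : ∀ c ∈ range (p - d), xG p ζ Z (l + 1) (c + p * k + (d + p * r)) *
      star (xG p ζ Z (l + 1) (c + p * k)) = Z ^ d * (xG p ζ (Z ^ p * ζ) l (k + r) * star (xG p ζ (Z ^ p * ζ) l k)) := by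
      intro c hc
      rw [mem_range] at hc
      have e : c + p * k + (d + p * r) = (c + d) + p * (k + r) := by ring
      rw [e, xG, xG, Nat.add_mul_mod_self_left, Nat.add_mul_mod_self_left, Nat.add_mul_div_left _ _ hp,
        Nat.add_mul_div_left _ _ hp, Nat.mod_eq_of_lt (by omega), Nat.mod_eq_of_lt (by omega),
        Nat.div_eq_of_lt (by omega), Nat.div_eq_of_lt (by omega), zero_add, zero_add, star_mul', star_pow,
        pow_add]
      linear_combination (Z ^ d * (xG p ζ (Z ^ p * ζ) l (k + r) * star (xG p ζ (Z ^ p * ζ) l k))) * huk c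
    have h2 : ∀ c ∈ range d, xG p ζ Z (l + 1) (p - d + c + p * k + (d + p * r)) *
      star (xG p ζ Z (l + 1) (p - d + c + p * k)) = Z ^ d * (star Z ^ p * (xG p ζ (Z ^ p * ζ) l (k + (r + 1)) * star (xG p ζ (Z ^ p * ζ) l k))) := by
      intro c hc
      rw [mem_range] at hc
      have e : p - d + c + p * k + (d + p * r) = c + p * (k + (r + 1)) := by
        have : p - d + c + p * k + (d + p * r) = (p - d + d) + c + p * k + p * r := by ring
        rw [this, Nat.sub_add_cancel hd.le]; ring
      rw [e, xG, xG, Nat.add_mul_mod_self_left, Nat.add_mul_mod_self_left, Nat.add_mul_div_left _ _ hp,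
        Nat.add_mul_div_left _ _ hp, Nat.mod_eq_of_lt (by omega), Nat.mod_eq_of_lt (by omega),
        Nat.div_eq_of_lt (by omega), Nat.div_eq_of_lt (by omega), zero_add, zero_add, star_mul', star_pow,
        pow_add]
      have e3 : star Z ^ p = star Z ^ (p - d) * star Z ^ d := by
        rw [← pow_add]; congr 1; omega
      rw [e3]
      linear_combination (star Z ^ (p - d) * (xG p ζ (Z ^ p * ζ) l (k + (r + 1)) * star (xG p ζ (Z ^ p * ζ) l k))) * (huk c - huk d)
    rw [sum_congr rfl h1, sum_congr rfl h2]
    simp only [sum_const, card_range, nsmul_eq_mul]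
    ring
  rw [sum_congr rfl key, ← mul_sum, sum_add_distrib, ← mul_sum, ← mul_sum, ← mul_sum,
    Nat.cast_sub hd.le]
  field_simp
  ring

lemma xC_rec' (p : ℕ) (hp : 0 < p) (ζ : ℂ) (Z : ℂ) (hZ : ‖Z‖ = 1) (l d r : ℕ)
    (hd : d ≤ p) :
    xC p ζ Z (l + 1) (d + p * r) = Z ^ d * ((1 - (d : ℂ) / p) * xC p ζ (Z ^ p * ζ) l r
      + (d : ℂ) / p * (star Z ^ p * xC p ζ (Z ^ p * ζ) l (r + 1))) := by
  rcases hd.lt_or_eq with h | rfl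
  · exact xC_rec p hp ζ Z hZ l d r h
  · have := xC_rec d hp ζ Z hZ l 0 (r + 1) hp
    have e : d + d * r = 0 + d * (r + 1) := by ring
    rw [e, this]
    have hpc : (d : ℂ) ≠ 0 := by exact_mod_cast hp.ne'
    have hu := unit_star hZ
    have huk : Z ^ d * star Z ^ d = 1 := by rw [← mul_pow, hu, one_pow]
    rw [div_self hpc]
    simp only [Nat.cast_zero, zero_div]
    linear_combination (-xC d ζ (Z ^ d * ζ) l (r + 1)) * huk

lemma interp_sq (t : ℝ) (a b : ℂ) :
    ‖(1 - (t : ℂ)) * a + t * b‖ ^ 2 = (1 - t) * ‖a‖ ^ 2 + t * ‖b‖ ^ 2 - t * (1 - t) * ‖a - b‖ ^ 2 := by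
  simp only [← Complex.normSq_eq_norm_sq, Complex.normSq_apply]
  simp
  ring

lemma det_bound (p : ℕ) (hp : 2 ≤ p) (ζ x y : ℂ) (hζ : ‖ζ‖ = 1) :
    ‖1 - ζ‖ ^ 4 / 17 * ‖x‖ ^ 2 ≤ ‖x - ζ * ((1 - 1 / (p : ℂ)) * x + 1 / p * y)‖ ^ 2
      + ‖1 / (p : ℂ) * x + (1 - 1 / p) * y - ζ * y‖ ^ 2 := by
  set D0 := x - ζ * ((1 - 1 / (p : ℂ)) * x + 1 / p * y) with h0
  set D1 := 1 / (p : ℂ) * x + (1 - 1 / p) * y - ζ * y with h1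
  have hpR : (2 : ℝ) ≤ p := by exact_mod_cast hp
  have hq : (1 : ℝ) / p ≤ 1 / 2 := by
    apply one_div_le_one_div_of_le <;> linarith
  have hq0 : (0 : ℝ) ≤ 1 / p := by positivity
  have key : (1 - ζ) ^ 2 * (1 - 1 / (p : ℂ)) * x = (1 - 1 / (p : ℂ) - ζ) * D0 + ζ / p * D1 := by
    rw [h0, h1]; ring
  have n1 : ‖1 - 1 / (p : ℂ)‖ = 1 - 1 / p := by
    have : (1 - 1 / (p : ℂ)) = ((1 - 1 / p : ℝ) : ℂ) := by push_cast; rfl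
    rw [this, Complex.norm_real, Real.norm_eq_abs, abs_of_nonneg (by linarith)]
  have hn : ‖1 - ζ‖ ^ 2 * (1 - 1 / p) * ‖x‖ ≤ 2 * ‖D0‖ + 1 / 2 * ‖D1‖ := by
    calc ‖1 - ζ‖ ^ 2 * (1 - 1 / p) * ‖x‖ = ‖(1 - ζ) ^ 2 * (1 - 1 / (p : ℂ)) * x‖ := by
          rw [norm_mul, norm_mul, norm_pow, n1]
      _ ≤ ‖(1 - 1 / (p : ℂ) - ζ)‖ * ‖D0‖ + ‖ζ / p‖ * ‖D1‖ := by
          rw [key]; refine (norm_add_le _ _).trans ?_; rw [norm_mul, norm_mul]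
      _ ≤ _ := by
          gcongr
          · refine (norm_sub_le _ _).trans ?_
            rw [n1, hζ]; linarith
          · rw [norm_div, hζ, Complex.norm_natCast]; exact hq
  have hn2 : ‖1 - ζ‖ ^ 2 * ‖x‖ ≤ 4 * ‖D0‖ + ‖D1‖ := by
    have : 0 ≤ ‖1 - ζ‖ ^ 2 * ‖x‖ := by positivity
    nlinarith
  have h4 : (‖1 - ζ‖ ^ 2 * ‖x‖) ^ 2 ≤ (4 * ‖D0‖ + ‖D1‖) ^ 2 := by gcongr
  nlinarith [sq_nonneg (‖D0‖ - 4 * ‖D1‖)]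

noncomputable def xQ (p : ℕ) (ζ Z : ℂ) (l s : ℕ) : ℝ := ∑ r ∈ range (p ^ s), ‖xC p ζ Z l r‖ ^ 2

lemma xQ_step1 (p : ℕ) (hp : 2 ≤ p) (ζ : ℂ) (hζ : ‖ζ‖ = 1) (Z : ℂ) (hZ : ‖Z‖ = 1) (l s : ℕ) :
    xQ p ζ Z (l + 1) (s + 1) ≤ p * xQ p ζ (Z ^ p * ζ) l s - 1 / (2 * p) *
      ∑ r ∈ range (p ^ s), ‖xC p ζ (Z ^ p * ζ) l r - star Z ^ p * xC p ζ (Z ^ p * ζ) l (r + 1)‖ ^ 2 := by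
  have hp0 : 0 < p := by omega
  have hpR : (2 : ℝ) ≤ p := by exact_mod_cast hp
  have hZ' : ‖Z ^ p * ζ‖ = 1 := by simp [hZ, hζ]
  unfold xQ
  rw [pow_succ, mul_comm (p ^ s) p, xs_block]
  set f : ℕ → ℂ := fun r => xC p ζ (Z ^ p * ζ) l r with hf
  have inner : ∀ r ∈ range (p ^ s), ∑ d ∈ range p, ‖xC p ζ Z (l + 1) (d + p * r)‖ ^ 2 ≤
      (∑ d ∈ range p, (1 - (d : ℝ) / p)) * ‖f r‖ ^ 2 + (∑ d ∈ range p, ((d : ℝ) / p)) * ‖f (r + 1)‖ ^ 2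
       - 1 / (2 * p) * ‖f r - star Z ^ p * f (r + 1)‖ ^ 2 := by
    intro r _
    have e : ∀ d ∈ range p, ‖xC p ζ Z (l + 1) (d + p * r)‖ ^ 2 =
       (1 - (d : ℝ) / p) * ‖f r‖ ^ 2 + ((d : ℝ) / p) * ‖f (r + 1)‖ ^ 2 -
         ((d : ℝ) / p) * (1 - (d : ℝ) / p) * ‖f r - star Z ^ p * f (r + 1)‖ ^ 2 := by
      intro d hd
      rw [xC_rec p hp0 ζ Z hZ l d r (mem_range.1 hd), norm_mul, norm_pow, hZ, one_pow, one_mul]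
      have := interp_sq ((d : ℝ) / p) (f r) (star Z ^ p * f (r + 1))
      rw [norm_mul (star Z ^ p), norm_pow, norm_star, hZ, one_pow, one_mul] at this
      rw [← this]; push_cast; rfl
    rw [sum_congr rfl e, sum_sub_distrib, sum_add_distrib, ← sum_mul, ← sum_mul, ← sum_mul]
    apply sub_le_sub_left
    gcongr
    have h1 : (1 : ℝ) / (2 * p) ≤ ((1 : ℕ) : ℝ) / p * (1 - ((1 : ℕ) : ℝ) / p) := by
      have : (1 : ℝ) / p ≤ 1 / 2 := by
        apply one_div_le_one_div_of_le <;> linarith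
      have h3 : (1 : ℝ) / (2 * p) = 1 / p * (1 / 2) := by field_simp
      rw [h3, Nat.cast_one]
      gcongr
      linarith
    refine h1.trans (single_le_sum (f := fun d : ℕ => (d : ℝ) / p * (1 - (d : ℝ) / p)) ?_ (mem_range.2 (by omega)))
    intro d hd
    have hd' : (d : ℝ) ≤ p := by exact_mod_cast (mem_range.1 hd).le
    have : (d : ℝ) / p ≤ 1 := by rw [div_le_one (by linarith)]; exact hd'
    have h0 : (0 : ℝ) ≤ (d : ℝ) / p := by positivity
    exact mul_nonneg h0 (by linarith)
  refine (sum_le_sum inner).trans ?_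
  rw [sum_sub_distrib, sum_add_distrib, ← mul_sum, ← mul_sum, ← mul_sum]
  have hshift : ∑ r ∈ range (p ^ s), ‖f (r + 1)‖ ^ 2 ≤ ∑ r ∈ range (p ^ s), ‖f r‖ ^ 2 := by
    have h1 := sum_range_succ (fun r => ‖f r‖ ^ 2) (p ^ s)
    have h2 := sum_range_succ' (fun r => ‖f r‖ ^ 2) (p ^ s)
    have h3 : f 0 = 1 := xC_zero p hp0 ζ hζ _ hZ' l
    have h4 : ‖f (p ^ s)‖ ≤ 1 := xC_le p hp0 ζ hζ _ hZ' l _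
    have h5 : ‖f (p ^ s)‖ ^ 2 ≤ 1 := pow_le_one₀ (norm_nonneg _) h4
    simp only [h3, norm_one, one_pow] at h2
    linarith
  have hb : 0 ≤ ∑ d ∈ range p, ((d : ℝ) / p) := sum_nonneg fun _ _ => by positivity
  have hab : ∑ d ∈ range p, (1 - (d : ℝ) / p) = p - ∑ d ∈ range p, ((d : ℝ) / p) := by
    rw [sum_sub_distrib]; simp
  rw [hab]
  have := mul_le_mul_of_nonneg_left hshift hb
  linarith

lemma xQ_step2 (p : ℕ) (hp : 2 ≤ p) (ζ : ℂ) (hζ : ‖ζ‖ = 1) (Z : ℂ) (hZ : ‖Z‖ = 1) (l s : ℕ) :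
    ‖1 - ζ‖ ^ 4 / 17 * xQ p ζ ((Z ^ p * ζ) ^ p * ζ) l s ≤ 
      ∑ r ∈ range (p ^ (s + 1)), ‖xC p ζ (Z ^ p * ζ) (l + 1) r - star Z ^ p * xC p ζ (Z ^ p * ζ) (l + 1) (r + 1)‖ ^ 2 := by
  have hp0 : 0 < p := by omega
  have hpc : (p : ℂ) ≠ 0 := by exact_mod_cast hp0.ne'
  have hZ' : ‖Z ^ p * ζ‖ = 1 := by simp [hZ, hζ]
  have hu := unit_star hZ
  have huk : Z ^ p * star Z ^ p = 1 := by rw [← mul_pow, hu, one_pow]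
  unfold xQ
  rw [show p ^ (s + 1) = p * p ^ s from pow_succ' p s, xs_block, mul_sum]
  apply sum_le_sum
  intro r _
  set W := Z ^ p * ζ with hW
  have hWζ : star Z ^ p * W = ζ := by rw [hW]; linear_combination ζ * huk
  set x := xC p ζ (W ^ p * ζ) l r with hx
  set y := star W ^ p * xC p ζ (W ^ p * ζ) l (r + 1) with hy
  have hR : ∀ d ≤ p, xC p ζ W (l + 1) (d + p * r) = W ^ d * ((1 - (d : ℂ) / p) * x + (d : ℂ) / p * y) :=
    fun d hd => xC_rec' p hp0 ζ W hZ' l d r hd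
  refine (det_bound p hp ζ x y hζ).trans ?_
  have hpair := add_le_sum (s := range p) (f := fun c => ‖xC p ζ W (l + 1) (c + p * r) - star Z ^ p * xC p ζ W (l + 1) (c + p * r + 1)‖ ^ 2)
    (fun i _ => by positivity) (i := 0) (j := p - 1) (mem_range.2 (by omega)) (mem_range.2 (by omega)) (by omega)
  refine le_trans (le_of_eq ?_) hpair
  congr 2
  · have e : 0 + p * r + 1 = 1 + p * r := by ring
    rw [e, hR 0 (by omega), hR 1 (by omega)]
    congr 1
    push_cast
    linear_combination ((1 - 1 / (p : ℂ)) * x + 1 / p * y) * hWζ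
  · have e : p - 1 + p * r + 1 = p + p * r := by omega
    rw [e, hR (p - 1) (by omega), hR p le_rfl]
    have e2 : W ^ p = W * W ^ (p - 1) := by
      rw [← pow_succ']; congr 1; omega
    have : W ^ (p - 1) * ((1 - ((p - 1 : ℕ) : ℂ) / p) * x + ((p - 1 : ℕ) : ℂ) / p * y) -
       star Z ^ p * (W ^ p * ((1 - (p : ℂ) / p) * x + (p : ℂ) / p * y)) = 
       W ^ (p - 1) * (1 / (p : ℂ) * x + (1 - 1 / p) * y - ζ * y) := by
      rw [e2, Nat.cast_sub (by omega : 1 ≤ p), div_self hpc, sub_div, div_self hpc, Nat.cast_one]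
      linear_combination (- W ^ (p - 1) * y) * hWζ
    rw [this, norm_mul, norm_pow, hZ', one_pow, one_mul]

noncomputable def xc (p : ℕ) (ζ : ℂ) : ℝ := ‖1 - ζ‖ ^ 4 / (34 * (p : ℝ) ^ 3)

lemma xQ_bound (p : ℕ) (hp : 2 ≤ p) (ζ : ℂ) (hζ : ‖ζ‖ = 1) (s : ℕ) : ∀ (Z : ℂ) (_ : ‖Z‖ = 1)
    (l : ℕ) (_ : s ≤ l), xQ p ζ Z l s ≤ (p : ℝ) ^ s * Real.exp (- xc p ζ * (((s : ℝ) - 1) / 2)) := by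
  have hp0 : 0 < p := by omega
  have hpR : (2 : ℝ) ≤ p := by exact_mod_cast hp
  have hc0 : 0 ≤ xc p ζ := by unfold xc; positivity
  induction s using Nat.twoStepInduction with
  | zero =>
    intro Z hZ l _
    unfold xQ
    simp only [pow_zero, range_one, sum_singleton, xC_zero p hp0 ζ hζ Z hZ l, norm_one, one_pow, one_mul]
    apply Real.one_le_exp
    have : (((0 : ℕ) : ℝ) - 1) / 2 = -(1 / 2) := by norm_num
    rw [this]; nlinarith
  | one =>
    intro Z hZ l _
    unfold xQ
    simp only [pow_one, Nat.cast_one, sub_self, zero_div, mul_zero, Real.exp_zero, mul_one]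
    calc ∑ r ∈ range p, ‖xC p ζ Z l r‖ ^ 2 ≤ ∑ r ∈ range p, (1 : ℝ) :=
          sum_le_sum fun r _ => pow_le_one₀ (norm_nonneg _) (xC_le p hp0 ζ hζ Z hZ l r)
      _ = p := by simp
  | more s ih _ =>
    intro Z hZ l hl
    obtain ⟨l, rfl⟩ : ∃ l', l = l' + 2 := ⟨l - 2, by omega⟩
    have hZ' : ‖Z ^ p * ζ‖ = 1 := by simp [hZ, hζ]
    have hZ'' : ‖(Z ^ p * ζ) ^ p * ζ‖ = 1 := by rw [norm_mul, norm_pow, hZ', hζ]; simp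
    have h1 := xQ_step1 p hp ζ hζ Z hZ (l + 1) (s + 1)
    have h2 := xQ_step1 p hp ζ hζ (Z ^ p * ζ) hZ' l s
    have h3 := xQ_step2 p hp ζ hζ Z hZ l s
    have h4 := ih _ hZ'' l (by omega)
    set D := ∑ r ∈ range (p ^ (s + 1)), ‖xC p ζ (Z ^ p * ζ) (l + 1) r - star Z ^ p * xC p ζ (Z ^ p * ζ) (l + 1) (r + 1)‖ ^ 2
    set q := xQ p ζ ((Z ^ p * ζ) ^ p * ζ) l s with hq
    have hq0 : 0 ≤ q := by rw [hq]; unfold xQ; positivity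
    have h2' : xQ p ζ (Z ^ p * ζ) (l + 1) (s + 1) ≤ p * q := by
      refine h2.trans (sub_le_self _ (by positivity))
    have hA : xQ p ζ Z (l + 1 + 1) (s + 1 + 1) ≤ p * (p * q) - 1 / (2 * p) * (‖1 - ζ‖ ^ 4 / 17 * q) := by
      refine h1.trans ?_
      gcongr
    have hB : p * (p * q) - 1 / (2 * p) * (‖1 - ζ‖ ^ 4 / 17 * q) = (p : ℝ) ^ 2 * q * (1 - xc p ζ) := by
      unfold xc; field_simp; ring
    have hC : 1 - xc p ζ ≤ Real.exp (- xc p ζ) := by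
      have := Real.add_one_le_exp (- xc p ζ); linarith
    calc _ ≤ (p : ℝ) ^ 2 * q * (1 - xc p ζ) := hA.trans hB.le
      _ ≤ (p : ℝ) ^ 2 * q * Real.exp (- xc p ζ) := by gcongr
      _ ≤ (p : ℝ) ^ 2 * ((p : ℝ) ^ s * Real.exp (- xc p ζ * (((s : ℝ) - 1) / 2))) * Real.exp (- xc p ζ) := by
          gcongr
      _ = _ := by
          rw [mul_assoc, mul_assoc, ← Real.exp_add, ← mul_assoc, ← pow_add]
          congr 2
          · ring
          · push_cast; ring

lemma xvdc (g : ℕ → ℂ) (hg : ∀ n, ‖g n‖ ≤ 1) (R N : ℕ) :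
    R * ‖∑ n ∈ range N, g n‖ ≤ ∑ n ∈ range N, ‖∑ r ∈ range R, g (n + r)‖ + 2 * (R : ℝ) ^ 2 := by
  have h1 : ∀ r, ‖∑ n ∈ range N, g n - ∑ n ∈ range N, g (n + r)‖ ≤ 2 * r := by
    intro r
    have e1 := sum_range_add g N r
    have e2 := sum_range_add g r N
    rw [add_comm r N, e1] at e2
    have e3 : ∑ n ∈ range N, g (n + r) = ∑ n ∈ range N, g (r + n) :=
      sum_congr rfl fun x _ => by rw [add_comm]
    have : ∑ n ∈ range N, g n - ∑ n ∈ range N, g (n + r) =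
        ∑ n ∈ range r, g n - ∑ n ∈ range r, g (N + n) := by
      rw [e3]; linear_combination e2
    rw [this]
    refine (norm_sub_le _ _).trans ?_
    have h2 : ‖∑ n ∈ range r, g n‖ ≤ r := by
      refine (norm_sum_le _ _).trans ((sum_le_sum fun i _ => hg i).trans ?_); simp
    have h3 : ‖∑ n ∈ range r, g (N + n)‖ ≤ r := by
      refine (norm_sum_le _ _).trans ((sum_le_sum fun i _ => hg (N + i)).trans ?_); simp
    linarith
  have e : (R : ℂ) * ∑ n ∈ range N, g n = ∑ n ∈ range N, ∑ r ∈ range R, g (n + r) +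
      ∑ r ∈ range R, (∑ n ∈ range N, g n - ∑ n ∈ range N, g (n + r)) := by
    rw [sum_sub_distrib, sum_comm]; simp
  have : (R : ℝ) * ‖∑ n ∈ range N, g n‖ = ‖(R : ℂ) * ∑ n ∈ range N, g n‖ := by
    rw [norm_mul, Complex.norm_natCast]
  rw [this, e]
  refine (norm_add_le _ _).trans (add_le_add (norm_sum_le _ _) ?_)
  refine (norm_sum_le _ _).trans ?_
  calc _ ≤ ∑ r ∈ range R, (2 * R : ℝ) := by
        refine sum_le_sum fun r hr => (h1 r).trans ?_
        have : (r : ℝ) ≤ R := by exact_mod_cast (mem_range.1 hr).le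
        linarith
    _ = _ := by simp; ring

lemma fe_rec (p : ℕ) (hp : p.Prime) (n : ℕ) :
    factorialExp p n = n / p + factorialExp p (n / p) := by
  haveI : Fact p.Prime := ⟨hp⟩
  unfold factorialExp
  rw [Nat.factorization_def _ hp, Nat.factorization_def _ hp, ← padicValNat_mul_div_factorial n, padicValNat_factorial_mul,
    add_comm]

lemma xtrunc (p : ℕ) (hp : p.Prime) (ζ : ℂ) (hζ : ‖ζ‖ = 1) (l : ℕ) : ∀ (Z : ℂ) (_ : ‖Z‖ = 1),
    ∃ H : ℕ → ℂ, (∀ n, ‖H n‖ = 1) ∧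
      ∀ n, Z ^ n * ζ ^ factorialExp p n = xG p ζ Z l n * H (n / p ^ l) := by
  induction l with
  | zero =>
    intro Z hZ
    exact ⟨fun n => Z ^ n * ζ ^ factorialExp p n, fun n => by simp [hZ, hζ], fun n => by simp [xG]⟩
  | succ l ih =>
    intro Z hZ
    obtain ⟨H, h1, h2⟩ := ih (Z ^ p * ζ) (by simp [hZ, hζ])
    refine ⟨H, h1, fun n => ?_⟩
    rw [xG, pow_succ', ← Nat.div_div_eq_div_mul, mul_assoc, ← h2, fe_rec p hp n]
    have : Z ^ n = Z ^ (n % p) * (Z ^ p) ^ (n / p) := by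
      rw [← pow_mul, ← pow_add, Nat.mod_add_div]
    rw [this]; ring

lemma xcount (N P R : ℕ) (hP : 0 < P) :
    ((range N).filter (fun n => P < n % P + R)).card ≤ (N / P + 1) * R := by
  have hN : N ≤ P * (N / P + 1) := (Nat.lt_mul_div_succ N hP).le
  calc ((range N).filter (fun n => P < n % P + R)).card
      ≤ ((range (P * (N / P + 1))).filter (fun n => P < n % P + R)).card :=
        card_le_card (filter_subset_filter _ (range_mono hN))
    _ = ∑ k ∈ range (N / P + 1), ∑ c ∈ range P, if P < (c + P * k) % P + R then 1 else 0 := by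
        rw [card_filter, xs_block]
    _ ≤ ∑ k ∈ range (N / P + 1), R := by
        refine sum_le_sum fun k _ => ?_
        rw [← card_filter]
        calc _ ≤ (Ico (P - R) P).card := by
              apply card_le_card
              intro c hc
              rw [mem_filter, mem_range, Nat.add_mul_mod_self_left] at hc
              obtain ⟨h1, h2⟩ := hc
              rw [Nat.mod_eq_of_lt h1] at h2
              rw [mem_Ico]; omega
          _ ≤ R := by rw [Nat.card_Ico]; omega
    _ = _ := by simp

lemma xshift (P : ℕ) (f : ℕ → ℂ) (hf : ∀ n, f (n + P) = f n) (t : ℕ) :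
    ∑ n ∈ range P, f (n + t) = ∑ n ∈ range P, f n := by
  induction t with
  | zero => simp
  | succ t ih =>
    rw [← ih]
    have h1 := sum_range_succ (fun n => f (n + t)) P
    have h2 := sum_range_succ' (fun n => f (n + t)) P
    rw [h1] at h2
    have h3 : f (P + t) = f (0 + t) := by rw [add_comm P t, hf, zero_add]
    rw [h3] at h2
    have h4 : ∀ n, n + (t + 1) = n + 1 + t := fun n => by ring
    simp only [h4]
    exact (add_right_cancel h2).symm

lemma xcrt (P M : ℕ) (hP : 0 < P) (hM : 0 < M) (hPM : P.Coprime M) (A B : ℕ → ℂ)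
    (hA : ∀ n, A (n % P) = A n) (hB : ∀ n, B (n % M) = B n) :
    ∑ n ∈ range (P * M), A n * B n = (∑ n ∈ range P, A n) * ∑ n ∈ range M, B n := by
  rw [sum_mul_sum, ← sum_product']
  refine sum_nbij (fun n => (n % P, n % M)) ?_ ?_ ?_ ?_
  · intro n _
    simp [Nat.mod_lt _ hP, Nat.mod_lt _ hM]
  · intro x hx y hy hxy
    simp only [coe_range, Set.mem_Iio, Prod.mk.injEq] at hx hy hxy
    have : x ≡ y [MOD P * M] := (Nat.modEq_and_modEq_iff_modEq_mul hPM).1 hxy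
    exact this.eq_of_lt_of_lt hx hy
  · rintro ⟨a, b⟩ hab
    simp only [coe_product, coe_range, Set.mem_prod, Set.mem_Iio] at hab
    refine ⟨Nat.chineseRemainder hPM a b, ?_, ?_⟩
    · simpa using Nat.chineseRemainder_lt_mul hPM a b hP.ne' hM.ne'
    · have := (Nat.chineseRemainder hPM a b).2
      have h1 := this.1
      have h2 := this.2
      unfold Nat.ModEq at h1 h2
      simp only [h1, h2, Nat.mod_eq_of_lt hab.1, Nat.mod_eq_of_lt hab.2]
  · intro n _
    simp only [hA, hB]

lemma xcorr (p : ℕ) (hp : 0 < p) (ζ : ℂ) (Z : ℂ) (l r d : ℕ) :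
    ∑ n ∈ range (p ^ l), xG p ζ Z l (n + (r + d)) * star (xG p ζ Z l (n + r)) =
      (p : ℂ) ^ l * xC p ζ Z l d := by
  have hpc : (p : ℂ) ≠ 0 := by exact_mod_cast hp.ne'
  have hper : ∀ n, xG p ζ Z l (n + p ^ l) = xG p ζ Z l n := fun n => by
    rw [← xG_mod p hp, Nat.add_mod_right, xG_mod p hp]
  have := xshift (p ^ l) (fun n => xG p ζ Z l (n + d) * star (xG p ζ Z l n)) (fun n => by
    simp only [hper, add_right_comm n (p ^ l) d]) r
  unfold xC
  rw [mul_div_cancel₀ _ (pow_ne_zero _ hpc), ← this]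
  exact sum_congr rfl fun n _ => by rw [add_assoc]

lemma xcorr_norm (p : ℕ) (hp : 0 < p) (ζ : ℂ) (Z : ℂ) (l r r' : ℕ) :
    ‖∑ n ∈ range (p ^ l), xG p ζ Z l (n + r) * star (xG p ζ Z l (n + r'))‖ =
      (p : ℝ) ^ l * ‖xC p ζ Z l (r - r' + (r' - r))‖ := by
  rcases le_total r' r with h | h
  · obtain ⟨d, rfl⟩ := Nat.exists_eq_add_of_le h
    rw [xcorr p hp, norm_mul, norm_pow, Complex.norm_natCast]
    congr 3; omega
  · obtain ⟨d, rfl⟩ := Nat.exists_eq_add_of_le h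
    rw [← norm_star, star_sum]
    have : ∀ n ∈ range (p ^ l), star (xG p ζ Z l (n + r) * star (xG p ζ Z l (n + (r + d)))) =
      xG p ζ Z l (n + (r + d)) * star (xG p ζ Z l (n + r)) := fun n _ => by
        rw [star_mul, star_star]
    rw [sum_congr rfl this, xcorr p hp, norm_mul, norm_pow, Complex.norm_natCast]
    congr 3; omega

lemma xdist (R r' : ℕ) (h : r' < R) (f : ℕ → ℝ) (hf : ∀ n, 0 ≤ f n) :
    ∑ r ∈ range R, f (r - r' + (r' - r)) ≤ 2 * ∑ d ∈ range R, f d := by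
  obtain ⟨t, rfl⟩ := Nat.exists_eq_add_of_le h.le
  rw [sum_range_add]
  have h1 : ∑ r ∈ range r', f (r - r' + (r' - r)) ≤ ∑ d ∈ range (r' + t), f d := by
    have : ∑ r ∈ range r', f (r - r' + (r' - r)) = ∑ r ∈ range r', f (r + 1) := by
      rw [← sum_range_reflect]
      refine sum_congr rfl fun r hr => ?_
      rw [mem_range] at hr
      congr 1; omega
    rw [this]
    have h2 := sum_range_succ' f r'
    have h3 : ∑ d ∈ range (r' + 1), f d ≤ ∑ d ∈ range (r' + t), f d :=
      sum_le_sum_of_subset_of_nonneg (range_mono (by omega)) fun _ _ _ => hf _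
    linarith [hf 0]
  have h2 : ∑ x ∈ range t, f (r' + x - r' + (r' - (r' + x))) ≤ ∑ d ∈ range (r' + t), f d := by
    have : ∑ x ∈ range t, f (r' + x - r' + (r' - (r' + x))) = ∑ x ∈ range t, f x :=
      sum_congr rfl fun r _ => by congr 1; omega
    rw [this]
    exact sum_le_sum_of_subset_of_nonneg (range_mono (by omega)) fun _ _ _ => hf _
  linarith

lemma xenergy (p : ℕ) (hp : 0 < p) (ζ : ℂ) (l M R : ℕ) (hM : 0 < M)
    (hPM : (p ^ l).Coprime M) (B : ℕ → ℂ) (hB : ∀ n, B (n % M) = B n) (hB1 : ∀ n, ‖B n‖ ≤ 1) :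
    ∑ n ∈ range (p ^ l * M), ‖∑ r ∈ range R, xG p ζ 1 l (n + r) * B (n + r)‖ ^ 2 ≤
      (p : ℝ) ^ l * M * (2 * R * ∑ d ∈ range R, ‖xC p ζ 1 l d‖) := by
  set A := xG p ζ 1 l with hAdef
  have hA : ∀ n, A (n % p ^ l) = A n := fun n => xG_mod p hp ζ l 1 n
  have hexp : ((∑ n ∈ range (p ^ l * M), ‖∑ r ∈ range R, A (n + r) * B (n + r)‖ ^ 2 : ℝ) : ℂ) =
      ∑ r' ∈ range R, ∑ r ∈ range R,
        (∑ n ∈ range (p ^ l), A (n + r) * star (A (n + r'))) *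
          (∑ n ∈ range M, B (n + r) * star (B (n + r'))) := by
    have : ∀ r' ∈ range R, ∀ r ∈ range R, 
        (∑ n ∈ range (p ^ l), A (n + r) * star (A (n + r'))) *
          (∑ n ∈ range M, B (n + r) * star (B (n + r'))) =
          ∑ n ∈ range (p ^ l * M), (A (n + r) * star (A (n + r'))) * (B (n + r) * star (B (n + r'))) := by
      intro r' _ r _
      refine (xcrt (p ^ l) M (by positivity) hM hPM _ _ (fun n => ?_) (fun n => ?_)).symm
      · rw [← hA (n % p ^ l + r), ← hA (n % p ^ l + r'), Nat.mod_add_mod, Nat.mod_add_mod, hA, hA]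
      · rw [← hB (n % M + r), ← hB (n % M + r'), Nat.mod_add_mod, Nat.mod_add_mod, hB, hB]
    rw [sum_congr rfl fun r' hr' => sum_congr rfl (this r' hr')]
    rw [sum_congr rfl fun r' hr' => sum_comm, sum_comm]
    push_cast
    refine sum_congr rfl fun n _ => ?_
    rw [← Complex.mul_conj', map_sum, sum_mul_sum, sum_comm]
    refine sum_congr rfl fun r' _ => sum_congr rfl fun r _ => ?_
    rw [map_mul]; simp only [Complex.star_def]; ring
  have h0 : 0 ≤ ∑ n ∈ range (p ^ l * M), ‖∑ r ∈ range R, A (n + r) * B (n + r)‖ ^ 2 := by positivity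
  rw [← abs_of_nonneg h0, ← Real.norm_eq_abs, ← Complex.norm_real, hexp]
  refine (norm_sum_le _ _).trans ?_
  have hin : ∀ r' ∈ range R, ‖∑ r ∈ range R,
        (∑ n ∈ range (p ^ l), A (n + r) * star (A (n + r'))) *
          (∑ n ∈ range M, B (n + r) * star (B (n + r')))‖ ≤
          (p : ℝ) ^ l * M * (2 * ∑ d ∈ range R, ‖xC p ζ 1 l d‖) := by
    intro r' hr'
    refine (norm_sum_le _ _).trans ?_
    calc _ ≤ ∑ r ∈ range R, (p : ℝ) ^ l * M * ‖xC p ζ 1 l (r - r' + (r' - r))‖ := by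
          refine sum_le_sum fun r _ => ?_
          rw [norm_mul, xcorr_norm p hp]
          have : ‖∑ n ∈ range M, B (n + r) * star (B (n + r'))‖ ≤ M := by
            refine (norm_sum_le _ _).trans ?_
            calc _ ≤ ∑ n ∈ range M, (1 : ℝ) := by
                  refine sum_le_sum fun n _ => ?_
                  rw [norm_mul, norm_star]
                  exact mul_le_one₀ (hB1 _) (norm_nonneg _) (hB1 _)
              _ = M := by simp
          calc _ ≤ (p : ℝ) ^ l * ‖xC p ζ 1 l (r - r' + (r' - r))‖ * M := by gcongr
            _ = _ := by ring
      _ ≤ _ := by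
          rw [← mul_sum]
          gcongr
          exact xdist R r' (mem_range.1 hr') (fun d => ‖xC p ζ 1 l d‖) (fun _ => norm_nonneg _)
  refine (sum_le_sum hin).trans (le_of_eq ?_)
  simp; ring

lemma xc_nonneg (p : ℕ) (ζ : ℂ) : 0 ≤ xc p ζ := by unfold xc; positivity

lemma xc_le_one (p : ℕ) (hp : 2 ≤ p) (ζ : ℂ) (hζ : ‖ζ‖ = 1) : xc p ζ ≤ 1 := by
  unfold xc
  have hpR : (2 : ℝ) ≤ p := by exact_mod_cast hp
  have h1 : ‖1 - ζ‖ ≤ 2 := by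
    refine (norm_sub_le _ _).trans ?_
    rw [hζ, norm_one]; norm_num
  have h2 : ‖1 - ζ‖ ^ 4 ≤ 2 ^ 4 := by gcongr
  have h3 : (2 : ℝ) ^ 3 ≤ (p : ℝ) ^ 3 := by gcongr
  rw [div_le_one (by positivity)]
  linarith

lemma xsumC (p : ℕ) (hp : 2 ≤ p) (ζ : ℂ) (hζ : ‖ζ‖ = 1) (l s : ℕ) (hl : s ≤ l) :
    ∑ d ∈ range (p ^ s), ‖xC p ζ 1 l d‖ ≤ (p : ℝ) ^ s * Real.exp (- xc p ζ * (((s : ℝ) - 1) / 4)) := by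
  have h1 := sq_sum_le_card_mul_sum_sq (s := range (p ^ s)) (f := fun d => ‖xC p ζ 1 l d‖)
  have h2 := xQ_bound p hp ζ hζ s 1 (by simp) l hl
  unfold xQ at h2
  rw [card_range] at h1
  refine le_of_sq_le_sq ?_ (by positivity)
  refine h1.trans ?_
  push_cast
  calc _ ≤ (p : ℝ) ^ s * ((p : ℝ) ^ s * Real.exp (- xc p ζ * (((s : ℝ) - 1) / 2))) := by gcongr
    _ = _ := by
      rw [mul_pow, ← Real.exp_nat_mul, ← mul_assoc, ← sq]
      congr 2
      push_cast; ring

lemma xdivadd (n r P : ℕ) (h : n % P + r < P) : (n + r) / P = n / P := by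
  have e : n + r = (n % P + r) + P * (n / P) := by
    have := Nat.mod_add_div n P; omega
  rw [e, Nat.add_mul_div_left _ _ (by omega), Nat.div_eq_of_lt h, zero_add]

lemma xexp (k : ℕ) (p : Fin k → ℕ) (hp : ∀ i, (p i).Prime) (hinj : Function.Injective p)
    (ζ : Fin k → ℂ) (hζ : ∀ i, ‖ζ i‖ = 1) (i0 : Fin k) :
    ∃ C : ℝ, 0 < C ∧ ∀ s N : ℕ, (p i0 ^ s) ^ (4 * k) ≤ N →
      ‖∑ n ∈ range N, ∏ i, ζ i ^ factorialExp (p i) n‖ ≤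
        C * N * Real.exp (- (xc (p i0) (ζ i0) / 8) * s) := by
  set c := xc (p i0) (ζ i0) with hc
  have hc0 : 0 ≤ c := xc_nonneg _ _
  have hc1 : c ≤ 1 := xc_le_one _ (hp i0).two_le _ (hζ i0)
  have hk : 0 < k := i0.pos
  set Y : ℝ := ∏ i, (p i : ℝ) with hY
  have hY0 : 0 ≤ Y := by positivity
  set K : ℝ := 2 * (1 + Y) with hK
  have hK1 : 1 ≤ K := by linarith
  refine ⟨K * Real.exp (c / 8) + (2 * k + 2), by positivity, ?_⟩
  intro s N hN
  set R := p i0 ^ s with hR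
  have hR0 : 0 < R := pow_pos (hp i0).pos s
  have hR2 : R ^ 2 ≤ N := (Nat.pow_le_pow_right hR0 (by omega)).trans hN
  have hR2k : R ^ (2 * k) ≤ N := (Nat.pow_le_pow_right hR0 (by omega)).trans hN
  have hRr : (0 : ℝ) < R := by exact_mod_cast hR0
  have hR2r : (R : ℝ) ^ 2 ≤ N := by exact_mod_cast hR2
  have hN0 : (0 : ℝ) < N := lt_of_lt_of_le (by positivity) hR2r
  set l : Fin k → ℕ := fun i => Nat.clog (p i) (R ^ 2) with hl
  set P : Fin k → ℕ := fun i => p i ^ l i with hP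
  have hP0 : ∀ i, 0 < P i := fun i => pow_pos (hp i).pos _
  have hPR : ∀ i, R ^ 2 ≤ P i := fun i => Nat.le_pow_clog (hp i).one_lt _
  have hPle : ∀ i, P i ≤ p i * R ^ 2 := by
    intro i
    rcases Nat.lt_or_ge 1 (R ^ 2) with h | h
    · have h1 := Nat.pow_pred_clog_lt_self (hp i).one_lt h
      have h2 : 0 < l i := Nat.clog_pos (hp i).one_lt h
      have h3 : P i = p i * p i ^ (l i).pred := by
        rw [← pow_succ']
        change p i ^ l i = _
        congr 1
        rw [Nat.pred_eq_sub_one]; omega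
      rw [h3]
      exact Nat.mul_le_mul_left _ h1.le
    · have : l i = 0 := Nat.clog_of_right_le_one h _
      have h3 : P i = 1 := by simp [hP, this]
      rw [h3]
      exact Nat.mul_pos (hp i).pos (by positivity)
  have hsl : s ≤ l i0 := by
    have h1 : p i0 ^ s ≤ p i0 ^ l i0 := by
      refine le_trans ?_ (hPR i0)
      rw [← hR]; nlinarith
    exact (Nat.pow_le_pow_iff_right (hp i0).one_lt).1 h1
  set M := ∏ i ∈ univ.erase i0, P i with hM
  have hM0 : 0 < M := prod_pos fun i _ => hP0 i
  have hPM : P i0 * M = ∏ i, P i := mul_prod_erase _ _ (mem_univ _)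
  have hcop : (P i0).Coprime M := by
    refine Nat.Coprime.prod_right fun i hi => ?_
    refine Nat.Coprime.pow _ _ ((Nat.coprime_primes (hp _) (hp _)).2 fun h => ?_)
    exact (mem_erase.1 hi).1 (hinj h).symm
  have hPMle : ((P i0 * M : ℕ) : ℝ) ≤ Y * N := by
    have h1 : (P i0 * M : ℕ) ≤ (∏ i, p i) * R ^ (2 * k) := by
      rw [hPM]
      refine (prod_le_prod' fun i _ => hPle i).trans (le_of_eq ?_)
      rw [prod_mul_distrib]; simp [← pow_mul]
    have h2 : (P i0 * M : ℕ) ≤ (∏ i, p i) * N := h1.trans (Nat.mul_le_mul_left _ hR2k)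
    calc ((P i0 * M : ℕ) : ℝ) ≤ (((∏ i, p i) * N : ℕ) : ℝ) := by exact_mod_cast h2
      _ = Y * N := by push_cast; rfl
  choose H hH1 hH2 using fun i => xtrunc (p i) (hp i) (ζ i) (hζ i) (l i) 1 (by simp)
  set T : Fin k → ℕ → ℂ := fun i n => xG (p i) (ζ i) 1 (l i) n with hT
  set B : ℕ → ℂ := fun n => ∏ i ∈ univ.erase i0, T i n with hB
  have hTB : ∀ n, T i0 n * B n = ∏ i, T i n := fun n => mul_prod_erase _ (fun i => T i n) (mem_univ _)
  have hT1 : ∀ i n, ‖T i n‖ = 1 := fun i n => xG_norm _ _ (hζ i) _ _ _ (by simp)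
  have hB1 : ∀ n, ‖B n‖ ≤ 1 := fun n => by simp [hB, norm_prod, hT1]
  have hBm : ∀ n, B (n % M) = B n := by
    intro n
    refine prod_congr rfl fun i hi => ?_
    have hd : P i ∣ M := dvd_prod_of_mem _ hi
    rw [hT]; dsimp only
    rw [← xG_mod _ (hp i).pos _ _ _ (n % M), Nat.mod_mod_of_dvd _ hd, xG_mod _ (hp i).pos]
  set g : ℕ → ℂ := fun n => ∏ i, ζ i ^ factorialExp (p i) n with hg
  have hg1 : ∀ n, ‖g n‖ ≤ 1 := fun n => by simp [hg, norm_prod, hζ]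
  have hgT : ∀ n, g n = (T i0 n * B n) * ∏ i, H i (n / P i) := by
    intro n
    rw [hTB, ← prod_mul_distrib]
    refine prod_congr rfl fun i _ => ?_
    rw [← hH2]; simp
  set a : ℕ → ℝ := fun n => ‖∑ r ∈ range R, T i0 (n + r) * B (n + r)‖ with ha
  have hpt : ∀ n, ‖∑ r ∈ range R, g (n + r)‖ ≤ a n + ∑ i, if P i < n % P i + R then (R : ℝ) else 0 := by
    intro n
    by_cases hbad : ∃ i, P i < n % P i + R
    · obtain ⟨i, hi⟩ := hbad
      have h1 : ‖∑ r ∈ range R, g (n + r)‖ ≤ R := by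
        refine (norm_sum_le _ _).trans ((sum_le_sum fun r _ => hg1 (n + r)).trans ?_); simp
      have h2 := single_le_sum (f := fun i => if P i < n % P i + R then (R : ℝ) else 0) (s := univ)
        (fun i _ => by positivity) (mem_univ i)
      simp only [hi, if_true] at h2
      have h3 : 0 ≤ a n := norm_nonneg _
      linarith
    · push Not at hbad
      have h1 : ∑ r ∈ range R, g (n + r) = (∑ r ∈ range R, T i0 (n + r) * B (n + r)) * ∏ i, H i (n / P i) := by
        rw [sum_mul]
        refine sum_congr rfl fun r hr => ?_
        rw [hgT]
        congr 1
        refine prod_congr rfl fun i _ => ?_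
        rw [xdivadd]
        have := hbad i; have := mem_range.1 hr; omega
      rw [h1, norm_mul, norm_prod]
      simp only [hH1, prod_const_one, mul_one]
      have : 0 ≤ ∑ i, if P i < n % P i + R then (R : ℝ) else 0 := by positivity
      linarith
  have hbadsum : ∑ n ∈ range N, ∑ i, (if P i < n % P i + R then (R : ℝ) else 0) ≤ 2 * k * N := by
    rw [sum_comm]
    calc _ ≤ ∑ i : Fin k, (2 * N : ℝ) := by
          refine sum_le_sum fun i _ => ?_
          rw [← sum_filter, sum_const, nsmul_eq_mul]
          have h1 := xcount N (P i) R (hP0 i)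
          have h2 : N / P i ≤ N / R ^ 2 := Nat.div_le_div_left (hPR i) (by positivity)
          have h3 : (((range N).filter (fun n => P i < n % P i + R)).card : ℝ) ≤ ((N / R ^ 2 : ℕ) + 1) * R := by
            have := h1.trans (Nat.mul_le_mul_right R (Nat.add_le_add_right h2 1))
            exact_mod_cast this
          have h4 : ((N / R ^ 2 : ℕ) : ℝ) ≤ N / R ^ 2 := by
            have := Nat.cast_div_le (α := ℝ) (m := N) (n := R ^ 2)
            push_cast at this; exact this
          calc _ ≤ (((N / R ^ 2 : ℕ) : ℝ) + 1) * R * R := by gcongr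
            _ ≤ ((N : ℝ) / R ^ 2 + 1) * R * R := by gcongr
            _ = N + R ^ 2 := by field_simp
            _ ≤ _ := by linarith
      _ = _ := by simp; ring
  have hE := xenergy (p i0) (hp i0).pos (ζ i0) (l i0) M R hM0 hcop B hBm hB1
  have hC := xsumC (p i0) (hp i0).two_le (ζ i0) (hζ i0) (l i0) s hsl
  set ρ := Real.exp (- c * (((s : ℝ) - 1) / 4)) with hρ
  have hρ2 : ρ = Real.exp (c / 8) ^ 2 * Real.exp (- (c / 8) * s) ^ 2 := by
    rw [hρ, ← Real.exp_nat_mul, ← Real.exp_nat_mul, ← Real.exp_add]; congr 1; push_cast; ring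
  have hsumsq : ∑ n ∈ range N, a n ^ 2 ≤ (1 + Y) * N * (2 * R * (R * ρ)) := by
    have hPT0 : 0 < P i0 * M := Nat.mul_pos (hP0 _) hM0
    have hNle : N ≤ P i0 * M * (N / (P i0 * M) + 1) := (Nat.lt_mul_div_succ N hPT0).le
    have hper : ∀ n k : ℕ, a (n + P i0 * M * k) = a n := by
      intro n k
      rw [ha]; dsimp only
      congr 1
      refine sum_congr rfl fun r _ => ?_
      have e : n + P i0 * M * k + r = (n + r) + P i0 * (M * k) := by ring
      have e' : n + P i0 * M * k + r = (n + r) + M * (P i0 * k) := by ring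
      congr 1
      · rw [e, hT]; dsimp only
        rw [← xG_mod _ (hp i0).pos, Nat.add_mul_mod_self_left, xG_mod _ (hp i0).pos]
      · rw [e', ← hBm, Nat.add_mul_mod_self_left, hBm]
    calc ∑ n ∈ range N, a n ^ 2 ≤ ∑ n ∈ range (P i0 * M * (N / (P i0 * M) + 1)), a n ^ 2 :=
          sum_le_sum_of_subset_of_nonneg (range_mono hNle) fun _ _ _ => by positivity
      _ = ((N / (P i0 * M) : ℕ) + 1 : ℝ) * ∑ n ∈ range (P i0 * M), a n ^ 2 := by
          rw [xs_block]; simp only [hper]; simp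
      _ ≤ ((N : ℝ) / (P i0 * M : ℕ) + 1) * (((P i0 * M : ℕ) : ℝ) * (2 * R * (R * ρ))) := by
          gcongr
          · exact Nat.cast_div_le
          · refine hE.trans ?_
            have e : ((P i0 * M : ℕ) : ℝ) = (p i0 : ℝ) ^ l i0 * M := by push_cast [hP]; rfl
            rw [e]
            gcongr
            refine hC.trans (le_of_eq ?_)
            rw [hR]; push_cast; rfl
      _ = (N + (P i0 * M : ℕ)) * (2 * R * (R * ρ)) := by
          have : ((P i0 * M : ℕ) : ℝ) ≠ 0 := by exact_mod_cast hPT0.ne'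
          field_simp
      _ ≤ _ := by
          gcongr
          linarith
  have hsuma : ∑ n ∈ range N, a n ≤ N * R * (K * Real.exp (c / 8) * Real.exp (- (c / 8) * s)) := by
    refine le_of_sq_le_sq ?_ (by positivity)
    refine (sq_sum_le_card_mul_sum_sq).trans ?_
    rw [card_range]
    calc _ ≤ (N : ℝ) * ((1 + Y) * N * (2 * R * (R * ρ))) := by gcongr
      _ = N ^ 2 * R ^ 2 * (K * 1) * ρ := by rw [hK]; ring
      _ ≤ N ^ 2 * R ^ 2 * (K * K) * ρ := by gcongr
      _ = _ := by rw [hρ2]; ring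
  have hV := xvdc g hg1 R N
  have hfin : R * ‖∑ n ∈ range N, g n‖ ≤ N * R * (K * Real.exp (c / 8) * Real.exp (- (c / 8) * s)) + 2 * k * N + 2 * N := by
    refine hV.trans ?_
    have h1 := sum_le_sum (s := range N) fun n _ => hpt n
    rw [sum_add_distrib] at h1
    linarith
  have hexpR : (1 : ℝ) ≤ R * Real.exp (- (c / 8) * s) := by
    have h2 : (2 : ℝ) ^ s ≤ R := by
      rw [hR]; push_cast; gcongr; exact_mod_cast (hp i0).two_le
    have h3 : Real.exp (c / 8 * s) ≤ 2 ^ s := by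
      rw [← Real.exp_log (show (0 : ℝ) < 2 by norm_num), ← Real.exp_nat_mul, Real.exp_le_exp, mul_comm]
      gcongr
      have := Real.log_two_gt_d9
      linarith
    calc (1 : ℝ) = Real.exp (c / 8 * s) * Real.exp (- (c / 8) * s) := by
          rw [← Real.exp_add]; simp
      _ ≤ _ := by gcongr; exact h3.trans h2
  refine le_of_mul_le_mul_left (hfin.trans ?_) hRr
  have : (2 * k + 2) * (N : ℝ) * 1 ≤ (2 * k + 2) * N * (R * Real.exp (- (c / 8) * s)) := by gcongr
  linarith

lemma xnat (m q : ℕ) (hm : 2 ≤ m) (hq : 2 ≤ q) : q ^ 4 * m ^ 2 ≤ q ^ (3 * m) := by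
  obtain ⟨j, rfl⟩ := Nat.exists_eq_add_of_le hm
  have h1 : (2 + j) ^ 2 ≤ 2 ^ (3 * j + 2) := by
    induction j with
    | zero => norm_num
    | succ j ih =>
      have ih := ih (by omega)
      have e : 2 ^ (3 * (j + 1) + 2) = 8 * 2 ^ (3 * j + 2) := by ring
      rw [e]; nlinarith
  have h2 : 2 ^ (3 * j + 2) ≤ q ^ (3 * j + 2) := Nat.pow_le_pow_left hq _
  calc q ^ 4 * (2 + j) ^ 2 ≤ q ^ 4 * q ^ (3 * j + 2) := Nat.mul_le_mul_left _ (h1.trans h2)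
    _ = q ^ (3 * (2 + j)) := by rw [← pow_add]; congr 1; ring

lemma xroot (m h : ℕ) (h0 : 0 < h) (hm : h < m) :
    4 / (m : ℝ) ≤ ‖1 - Complex.exp (2 * Real.pi * Complex.I / m) ^ h‖ := by
  have hmR : (0 : ℝ) < m := by exact_mod_cast (by omega : 0 < m)
  have e : Complex.exp (2 * Real.pi * Complex.I / m) ^ h =
      Complex.exp (Complex.I * ((2 * (Real.pi * (h / m)) : ℝ) : ℂ)) := by
    rw [← Complex.exp_nat_mul]; congr 1; push_cast; ring
  rw [norm_sub_rev, e, Complex.norm_exp_I_mul_ofReal_sub_one, mul_div_cancel_left₀ _ (by norm_num : (2 : ℝ) ≠ 0)]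
  have key : ∀ t : ℝ, 1 / m ≤ t → t ≤ 1 / 2 → 2 / (m : ℝ) ≤ Real.sin (Real.pi * t) := by
    intro t h1 h2
    have hpi := Real.pi_pos
    have ht : 0 ≤ t := le_trans (by positivity) h1
    have := Real.mul_le_sin (x := Real.pi * t) (by positivity) (by nlinarith)
    refine le_trans ?_ this
    have e : 2 / Real.pi * (Real.pi * t) = 2 * t := by field_simp
    rw [e]
    calc 2 / (m : ℝ) = 2 * (1 / m) := by ring
      _ ≤ 2 * t := by gcongr
  have hs : 2 / (m : ℝ) ≤ Real.sin (Real.pi * (h / m)) := by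
    have h0R : (1 : ℝ) ≤ h := by exact_mod_cast h0
    have hmR' : (h : ℝ) + 1 ≤ m := by exact_mod_cast hm
    rcases le_total ((h : ℝ) / m) (1 / 2) with hh | hh
    · exact key _ (by gcongr) hh
    · rw [← Real.sin_pi_sub]
      have e : Real.pi - Real.pi * (h / m) = Real.pi * (1 - h / m) := by ring
      rw [e]
      apply key _ _ (by linarith)
      rw [le_sub_iff_add_le, ← add_div, div_le_one hmR]; linarith
  rw [Real.norm_eq_abs]
  refine le_trans ?_ (le_abs_self _)
  calc 4 / (m : ℝ) = 2 * (2 / m) := by ring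
    _ ≤ _ := by gcongr

lemma xpower (k : ℕ) (p : Fin k → ℕ) (hp : ∀ i, (p i).Prime) (hinj : Function.Injective p)
    (ζ : Fin k → ℂ) (hζ : ∀ i, ‖ζ i‖ = 1) (i0 : Fin k) (Pm Mm : ℕ) (hPm : p i0 ≤ Pm) (hMm : 2 ≤ Mm)
    (hroot : 4 / (Mm : ℝ) ≤ ‖1 - ζ i0‖) :
    ∃ C : ℝ, 0 < C ∧ ∀ N : ℕ, 0 < N →
      ‖∑ n ∈ range N, ∏ i, ζ i ^ factorialExp (p i) n‖ ≤
        C * (N : ℝ) ^ (1 - 1 / (120 * (k : ℝ) ^ 2 * (Pm : ℝ) ^ (3 * Mm) * (Mm : ℝ) ^ 2)) := by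
  obtain ⟨C, hC0, hC⟩ := xexp k p hp hinj ζ hζ i0
  set c := xc (p i0) (ζ i0) with hc
  set δ : ℝ := 1 / (120 * (k : ℝ) ^ 2 * (Pm : ℝ) ^ (3 * Mm) * (Mm : ℝ) ^ 2) with hδ
  have hk : 0 < k := i0.pos
  have hkR : (1 : ℝ) ≤ k := by exact_mod_cast hk
  set q := p i0 with hq
  have hq2 : 2 ≤ q := (hp i0).two_le
  have hqR : (2 : ℝ) ≤ q := by exact_mod_cast hq2
  have hMR : (2 : ℝ) ≤ Mm := by exact_mod_cast hMm
  have hPR : (q : ℝ) ≤ Pm := by exact_mod_cast hPm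
  have hδ0 : 0 ≤ δ := by rw [hδ]; positivity
  have hcl : 7 / ((q : ℝ) ^ 3 * Mm ^ 4) ≤ c := by
    rw [hc]; unfold xc
    have h4 : (4 / (Mm : ℝ)) ^ 4 ≤ ‖1 - ζ i0‖ ^ 4 := by gcongr
    calc 7 / ((q : ℝ) ^ 3 * Mm ^ 4) ≤ (256 / 34) / ((q : ℝ) ^ 3 * Mm ^ 4) := by gcongr; norm_num
      _ = (4 / (Mm : ℝ)) ^ 4 / (34 * (q : ℝ) ^ 3) := by field_simp; norm_num
      _ ≤ _ := by gcongr
  have hmain : 4 * k * δ * Real.log q ≤ c / 8 := by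
    have hlog : Real.log q ≤ q := by
      have := Real.log_le_sub_one_of_pos (show (0 : ℝ) < q by linarith); linarith
    have hn : (q : ℝ) ^ 4 * (Mm : ℝ) ^ 2 ≤ (q : ℝ) ^ (3 * Mm) := by exact_mod_cast xnat Mm q hMm hq2
    have hn2 : (q : ℝ) ^ (3 * Mm) ≤ (Pm : ℝ) ^ (3 * Mm) := by gcongr
    have hδle : δ ≤ 1 / (120 * k * ((q : ℝ) ^ 4 * (Mm : ℝ) ^ 2) * (Mm : ℝ) ^ 2) := by
      rw [hδ]
      apply one_div_le_one_div_of_le (by positivity)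
      have : (k : ℝ) ≤ (k : ℝ) ^ 2 := by nlinarith
      gcongr
      exact hn.trans hn2
    calc 4 * k * δ * Real.log q ≤ 4 * k * (1 / (120 * k * ((q : ℝ) ^ 4 * (Mm : ℝ) ^ 2) * (Mm : ℝ) ^ 2)) * q := by
          gcongr
      _ = (1 / 30) / ((q : ℝ) ^ 3 * Mm ^ 4) := by
          have : (k : ℝ) ≠ 0 := by linarith
          field_simp; norm_num
      _ ≤ (7 / 8) / ((q : ℝ) ^ 3 * Mm ^ 4) := by gcongr <;> norm_num
      _ = 7 / ((q : ℝ) ^ 3 * Mm ^ 4) / 8 := by ring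
      _ ≤ _ := by gcongr
  refine ⟨C * Real.exp (c / 8), by positivity, fun N hN => ?_⟩
  have hN0 : (0 : ℝ) < N := by exact_mod_cast hN
  have hb : 1 < q ^ (4 * k) := Nat.one_lt_pow (by omega) hq2
  set s := Nat.log (q ^ (4 * k)) N with hs
  have h1 : (q ^ s) ^ (4 * k) ≤ N := by
    rw [← pow_mul, mul_comm, pow_mul]; exact Nat.pow_log_le_self _ hN.ne'
  have h2 : N < (q ^ (4 * k)) ^ (s + 1) := Nat.lt_pow_succ_log_self hb N
  refine (hC s N h1).trans ?_
  have hlogN : Real.log N ≤ 4 * k * (s + 1) * Real.log q := by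
    have : (N : ℝ) ≤ (q : ℝ) ^ (4 * k * (s + 1)) := by
      rw [pow_mul]; exact_mod_cast h2.le
    have := Real.log_le_log hN0 this
    rw [Real.log_pow] at this
    push_cast at this; exact this
  have hexp : Real.exp (-(c / 8) * s) ≤ Real.exp (c / 8) * (N : ℝ) ^ (-δ) := by
    rw [Real.rpow_def_of_pos hN0, ← Real.exp_add, Real.exp_le_exp]
    have h3 := mul_le_mul_of_nonneg_left hlogN hδ0
    have h4 := mul_le_mul_of_nonneg_right hmain (show (0 : ℝ) ≤ s + 1 by positivity)
    linarith
  have e : (N : ℝ) ^ (1 - δ) = N * (N : ℝ) ^ (-δ) := by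
    rw [sub_eq_add_neg, Real.rpow_add hN0, Real.rpow_one]
  rw [e]
  calc _ ≤ C * N * (Real.exp (c / 8) * (N : ℝ) ^ (-δ)) := by gcongr
    _ = _ := by ring

lemma xind (m : ℕ) (hm : 0 < m) (ω : ℂ) (hω : IsPrimitiveRoot ω m) (e a : ℕ) [Decidable (e ≡ a [MOD m])] :
    (if e ≡ a [MOD m] then (1 : ℂ) else 0) =
      ∑ h ∈ range m, (1 / (m : ℂ)) * ((ω ^ h) ^ e * ((ω ^ h) ^ a)⁻¹) := by
  have hω0 : ω ≠ 0 := hω.ne_zero hm.ne'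
  have hmC : (m : ℂ) ≠ 0 := by exact_mod_cast hm.ne'
  have hz : ∀ h : ℕ, (ω ^ h) ^ e * ((ω ^ h) ^ a)⁻¹ = (ω ^ ((e : ℤ) - a)) ^ h := by
    intro h
    rw [zpow_sub₀ hω0, zpow_natCast, zpow_natCast, div_pow, div_eq_mul_inv, ← pow_mul, ← pow_mul,
      ← pow_mul, ← pow_mul, mul_comm h e, mul_comm h a]
  simp only [hz]
  rw [← mul_sum]
  have hiff : ω ^ ((e : ℤ) - a) = 1 ↔ e ≡ a [MOD m] := by
    rw [hω.zpow_eq_one_iff_dvd, Nat.ModEq.comm, Nat.modEq_iff_dvd]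
  split_ifs with hea
  · rw [hiff.2 hea]; simp [hmC]
  · have hne : ω ^ ((e : ℤ) - a) ≠ 1 := fun h => hea (hiff.1 h)
    rw [geom_sum_eq hne]
    have : (ω ^ ((e : ℤ) - a)) ^ m = 1 := by
      rw [← zpow_natCast, ← zpow_mul, mul_comm, zpow_mul, zpow_natCast, hω.pow_eq_one, one_zpow]
    rw [this]; simp

end

open scoped Classical in
/-- For distinct primes `p₁,…,p_k`, moduli `m₁,…,m_k ≥ 2` with
`pᵢ ∤ mᵢ`, and residues `0 ≤ aᵢ ≤ mᵢ - 1`, the count of `0 ≤ n < N` with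
`e_{pᵢ}(n) ≡ aᵢ (mod mᵢ)` for all `i` equals `N/(m₁⋯m_k) + O(N^{1-δ})` with
`δ = 1/(120 k² p^{3m} m²)`, `m = max mᵢ`, `p = max pᵢ`. -/
theorem stmt_0 (k : ℕ) (hk : 0 < k) (p m : Fin k → ℕ)
    (hp : ∀ i, (p i).Prime) (hpdist : Function.Injective p)
    (hm : ∀ i, 2 ≤ m i) (hpm : ∀ i, ¬ p i ∣ m i)
    (a : Fin k → ℕ) (ha : ∀ i, a i ≤ m i - 1) :
    ∃ C : ℝ, 0 < C ∧ ∀ N : ℕ, 0 < N →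
      |(((Finset.range N).filter
            (fun n => ∀ i, factorialExp (p i) n ≡ a i [MOD m i])).card : ℝ) -
          (N : ℝ) / ∏ i, (m i : ℝ)| ≤
        C * (N : ℝ) ^
          (1 - 1 / (120 * (k : ℝ) ^ 2 *
            ((Finset.univ.sup p : ℕ) : ℝ) ^ (3 * Finset.univ.sup m) *
            ((Finset.univ.sup m : ℕ) : ℝ) ^ 2)) := by
  set Pm := Finset.univ.sup p with hPm
  set Mm := Finset.univ.sup m with hMm
  have hMi : ∀ i, m i ≤ Mm := fun i => Finset.le_sup (f := m) (Finset.mem_univ i)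
  have hPi : ∀ i, p i ≤ Pm := fun i => Finset.le_sup (f := p) (Finset.mem_univ i)
  have hM2 : 2 ≤ Mm := (hm ⟨0, hk⟩).trans (hMi _)
  set ω : Fin k → ℂ := fun i => Complex.exp (2 * Real.pi * Complex.I / m i) with hω
  have hωp : ∀ i, IsPrimitiveRoot (ω i) (m i) := fun i =>
    Complex.isPrimitiveRoot_exp (m i) (by have := hm i; omega)
  have hω1 : ∀ i, ‖ω i‖ = 1 := fun i => (hωp i).norm'_eq_one (by have := hm i; omega)
  set E : ℝ := 1 - 1 / (120 * (k : ℝ) ^ 2 * (Pm : ℝ) ^ (3 * Mm) * (Mm : ℝ) ^ 2) with hE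
  set I := Fintype.piFinset fun i => Finset.range (m i) with hI
  have hbd : ∀ h : Fin k → ℕ, ∃ C : ℝ, 0 < C ∧ (h ∈ I → h ≠ 0 → ∀ N : ℕ, 0 < N →
      ‖∑ n ∈ Finset.range N, ∏ i, (ω i ^ h i) ^ factorialExp (p i) n‖ ≤ C * (N : ℝ) ^ E) := by
    intro h
    by_cases hh : h ∈ I ∧ h ≠ 0
    · obtain ⟨h1, h2⟩ := hh
      obtain ⟨i0, hi0⟩ := Function.ne_iff.1 h2
      have h3 := Finset.mem_range.1 (Fintype.mem_piFinset.1 h1 i0)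
      have hmR : (0 : ℝ) < m i0 := by exact_mod_cast (by omega : 0 < m i0)
      have h4 : 4 / (Mm : ℝ) ≤ ‖1 - ω i0 ^ h i0‖ := by
        refine le_trans ?_ (xroot (m i0) (h i0) (Nat.pos_of_ne_zero hi0) h3)
        have : (m i0 : ℝ) ≤ Mm := by exact_mod_cast hMi i0
        gcongr
      obtain ⟨C, hC, hC2⟩ := xpower k p hp hpdist (fun i => ω i ^ h i) (fun i => by simp [hω1]) i0 Pm Mm
        (hPi i0) hM2 h4
      exact ⟨C, hC, fun _ _ => hC2⟩
    · exact ⟨1, one_pos, fun h1 h2 => absurd ⟨h1, h2⟩ hh⟩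
  choose C hC0 hC using hbd
  refine ⟨∑ h ∈ I, C h + 1, by have := Finset.sum_nonneg fun h (_ : h ∈ I) => (hC0 h).le; linarith, ?_⟩
  intro N hN
  have h0I : (0 : Fin k → ℕ) ∈ I := by
    rw [hI, Fintype.mem_piFinset]; intro i; have := hm i; simp; omega
  set V : (Fin k → ℕ) → ℂ := fun h => ∏ i, ((1 / (m i : ℂ)) * ((ω i ^ h i) ^ a i)⁻¹) with hV
  have hV1 : ∀ h, ‖V h‖ ≤ 1 := by
    intro h
    rw [hV]; dsimp only
    rw [norm_prod]
    refine Finset.prod_le_one (fun _ _ => norm_nonneg _) fun i _ => ?_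
    have : (1 : ℝ) ≤ m i := by exact_mod_cast (by have := hm i; omega : 1 ≤ m i)
    simp [hω1]
    exact inv_le_one_of_one_le₀ this
  have hcount : (((Finset.range N).filter
            (fun n => ∀ i, factorialExp (p i) n ≡ a i [MOD m i])).card : ℂ) =
      ∑ h ∈ I, V h * ∑ n ∈ Finset.range N, ∏ i, (ω i ^ h i) ^ factorialExp (p i) n := by
    rw [Finset.card_filter]
    push_cast
    have : ∀ n ∈ Finset.range N, (if ∀ i, factorialExp (p i) n ≡ a i [MOD m i] then (1 : ℂ) else 0) =
        ∑ h ∈ I, V h * ∏ i, (ω i ^ h i) ^ factorialExp (p i) n := by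
      intro n _
      have e1 : (if ∀ i, factorialExp (p i) n ≡ a i [MOD m i] then (1 : ℂ) else 0) =
          ∏ i, if factorialExp (p i) n ≡ a i [MOD m i] then (1 : ℂ) else 0 := by
        rw [Finset.prod_ite_zero]; simp
      rw [e1, Finset.prod_congr rfl fun i _ => xind (m i) (by have := hm i; omega) (ω i) (hωp i) _ _,
        Finset.prod_univ_sum]
      refine Finset.sum_congr rfl fun h _ => ?_
      rw [hV]; dsimp only
      rw [← Finset.prod_mul_distrib]
      exact Finset.prod_congr rfl fun i _ => by ring
    rw [Finset.sum_congr rfl this, Finset.sum_comm]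
    exact Finset.sum_congr rfl fun h _ => by rw [Finset.mul_sum]
  rw [← Finset.add_sum_erase _ _ h0I] at hcount
  have hzero : V 0 * ∑ n ∈ Finset.range N, ∏ i, (ω i ^ (0 : Fin k → ℕ) i) ^ factorialExp (p i) n =
      (((N : ℝ) / ∏ i, (m i : ℝ) : ℝ) : ℂ) := by
    rw [hV]; simp [div_eq_mul_inv, mul_comm]
  rw [hzero] at hcount
  rw [← Real.norm_eq_abs, ← Complex.norm_real, Complex.ofReal_sub, Complex.ofReal_natCast, hcount,
    add_sub_cancel_left]
  refine (norm_sum_le _ _).trans ?_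
  have hNE : 0 ≤ (N : ℝ) ^ E := by positivity
  calc _ ≤ ∑ h ∈ I.erase 0, C h * (N : ℝ) ^ E := by
        refine Finset.sum_le_sum fun h hh => ?_
        obtain ⟨h1, h2⟩ := Finset.mem_erase.1 hh
        rw [norm_mul]
        exact (mul_le_of_le_one_left (norm_nonneg _) (hV1 h)).trans (hC h h2 h1 N hN)
    _ ≤ ∑ h ∈ I, C h * (N : ℝ) ^ E :=
        Finset.sum_le_sum_of_subset_of_nonneg (Finset.erase_subset _ _) fun h _ _ => 
          mul_nonneg (hC0 h).le hNE
    _ ≤ _ := by rw [← Finset.sum_mul]; gcongr; linarith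
end

section
/- Let p_1, …, p_k be distinct primes, let m_1, …, m_k be integers with m_i ≥ 2, and assume p_i does not divide m_i for each i = 1, …, k. Let a_1, …, a_k be integers with 0 ≤ a_i ≤ m_i − 1. Then #{0 ≤ n < N : e_{p_i}(n) ≡ a_i (mod m_i) for all 1 ≤ i ≤ k} is asymptotic to N/(m_1 ⋯ m_k) as N → ∞; that is, the limit of the ratio of the left-hand side to N/(m_1 ⋯ m_k) equals 1. -/
open Finset

lemma block_sum {E : Type*} [AddCommMonoid E] (h : ℕ → E) (a b : ℕ) :
    ∑ n ∈ range (a * b), h n = ∑ y ∈ range a, ∑ x ∈ range b, h (b * y + x) := by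
  induction a with
  | zero => simp
  | succ a ih =>
    rw [Nat.succ_mul, Finset.sum_range_add, ih, Finset.sum_range_succ]
    simp [mul_comm]

lemma coprime_sum (M Q x : ℕ) (hM : 0 < M) (hc : Nat.Coprime M Q) (g : ℕ → ℂ)
    (hg : ∀ n, g (n % M) = g n) :
    ∑ y ∈ range M, g (Q * y + x) = ∑ y ∈ range M, g y := by
  have hinj : Set.InjOn (fun y => (Q * y + x) % M) (range M : Set ℕ) := by
    intro y hy z hz hyz
    have h1 : Q * y + x ≡ Q * z + x [MOD M] := hyz
    have h2 := Nat.ModEq.cancel_left_of_coprime (by simpa using hc) (Nat.ModEq.add_right_cancel' x h1)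
    simp at hy hz
    exact h2.eq_of_lt_of_lt hy hz
  have him : (range M).image (fun y => (Q * y + x) % M) = range M := by
    apply Finset.eq_of_subset_of_card_le
    · intro z hz
      simp only [Finset.mem_image, Finset.mem_range] at hz ⊢
      obtain ⟨y, _, rfl⟩ := hz
      exact Nat.mod_lt _ hM
    · rw [Finset.card_image_of_injOn hinj]
  conv_rhs => rw [← him]
  rw [Finset.sum_image hinj]
  exact Finset.sum_congr rfl fun y _ => (hg _).symm

/-- correlation term -/
noncomputable def corrD (f : ℕ → ℂ) (r n : ℕ) : ℂ := f (n + r) * (starRingEnd ℂ) (f n)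

lemma corrD_norm {f : ℕ → ℂ} (hf : ∀ n, ‖f n‖ = 1) (r n : ℕ) : ‖corrD f r n‖ = 1 := by
  simp [corrD, hf]

lemma shift_bound (g : ℕ → ℂ) (hg : ∀ n, ‖g n‖ ≤ 1) (N r : ℕ) :
    ‖∑ n ∈ range N, g (n + r) - ∑ n ∈ range N, g n‖ ≤ 2 * r := by
  have h1 : ∑ n ∈ range N, g (n + r) - ∑ n ∈ range N, g n
      = ∑ n ∈ range r, g (N + n) - ∑ n ∈ range r, g n := by
    have e1 := Finset.sum_range_add g N r
    have e2 := Finset.sum_range_add g r N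
    rw [add_comm r N, e1] at e2
    have e3 : ∑ n ∈ range N, g (n + r) = ∑ n ∈ range N, g (r + n) := by simp [add_comm]
    rw [e3]
    linear_combination -e2
  rw [h1]
  have b1 : ‖∑ n ∈ range r, g (N + n)‖ ≤ r := by
    simpa using Finset.sum_le_sum (fun n (_ : n ∈ range r) => hg (N+n)) |> (norm_sum_le _ _).trans
  have b2 : ‖∑ n ∈ range r, g n‖ ≤ r := by
    simpa using Finset.sum_le_sum (fun n (_ : n ∈ range r) => hg n) |> (norm_sum_le _ _).trans
  have := norm_sub_le (∑ n ∈ range r, g (N + n)) (∑ n ∈ range r, g n)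
  linarith

lemma pair_bound (F : ℕ → ℂ) (hF : ∀ n, ‖F n‖ = 1) (N R : ℕ) (T : ℕ → ℝ)
    (hT : ∀ h < R, ‖∑ n ∈ range N, corrD F h n‖ ≤ T h) (r r' : ℕ) (hr : r < R) (hr' : r' ≤ r) :
    ‖∑ n ∈ range N, F (n + r) * (starRingEnd ℂ) (F (n + r'))‖ ≤ T (r - r') + 2 * R := by
  have h := shift_bound (corrD F (r - r')) (fun n => (corrD_norm hF _ n).le) N r'
  have e : ∑ n ∈ range N, F (n + r) * (starRingEnd ℂ) (F (n + r'))
      = ∑ n ∈ range N, corrD F (r - r') (n + r') := by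
    refine Finset.sum_congr rfl fun n _ => ?_
    unfold corrD
    rw [show n + r' + (r - r') = n + r by omega]
  rw [e]
  have h2 := hT (r - r') (by omega)
  have h3 := norm_le_norm_sub_add (∑ n ∈ range N, corrD F (r - r') (n + r')) (∑ n ∈ range N, corrD F (r - r') n)
  have : (r' : ℝ) ≤ R := by exact_mod_cast (by omega : r' ≤ R)
  linarith

lemma vdc (F : ℕ → ℂ) (hF : ∀ n, ‖F n‖ = 1) (R : ℕ) (hR : 0 < R) (τ : ℕ → ℝ) (C ε : ℝ)
    (hC : 0 ≤ C) (hτ0 : ∀ h, 0 ≤ τ h)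
    (hτ : ∑ h ∈ range R, τ h ≤ ε * R)
    (hT : ∀ h < R, ∀ N : ℕ, ‖∑ n ∈ range N, corrD F h n‖ ≤ τ h * N + C) :
    ∃ C' : ℝ, ∀ N : ℕ, ‖∑ n ∈ range N, F n‖ ^ 2 ≤ 4 * ε * N ^ 2 + C' * (N + 1) := by
  refine ⟨2 * (C + 2 * R) + 8 * R ^ 2, fun N => ?_⟩
  have hR' : (0 : ℝ) < R := by exact_mod_cast hR
  have hN : (0 : ℝ) ≤ N := by positivity
  set S := ∑ n ∈ range N, F n with hS
  set U := ∑ n ∈ range N, ∑ r ∈ range R, F (n + r) with hU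
  have h1 : ‖U - R * S‖ ≤ 2 * R ^ 2 := by
    have : U - R * S = ∑ r ∈ range R, (∑ n ∈ range N, F (n + r) - S) := by
      rw [hU, Finset.sum_comm, Finset.sum_sub_distrib]; simp
    rw [this]
    calc _ ≤ ∑ r ∈ range R, ‖∑ n ∈ range N, F (n + r) - S‖ := norm_sum_le _ _
      _ ≤ ∑ r ∈ range R, (2 * R : ℝ) := by
        refine Finset.sum_le_sum fun r hr => ?_
        have := shift_bound F (fun n => (hF n).le) N r
        have h3 : (r : ℝ) ≤ R := by exact_mod_cast (Finset.mem_range.1 hr).le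
        linarith
      _ = _ := by simp; ring
  have hpair : ∀ r ∈ range R, ∀ r' ∈ range R,
      ‖∑ n ∈ range N, F (n + r) * (starRingEnd ℂ) (F (n + r'))‖
        ≤ (if r' ≤ r then τ (r - r') else 0) * N + (if r ≤ r' then τ (r' - r) else 0) * N
          + (C + 2 * R) := by
    intro r hr r' hr'
    rw [Finset.mem_range] at hr hr'
    have n1 : 0 ≤ (if r' ≤ r then τ (r - r') else 0) * N :=
      mul_nonneg (by split_ifs <;> simp [hτ0]) hN
    have n2 : 0 ≤ (if r ≤ r' then τ (r' - r) else 0) * N :=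
      mul_nonneg (by split_ifs <;> simp [hτ0]) hN
    rcases le_total r' r with h | h
    · have := pair_bound F hF N R (fun h => τ h * N + C) (fun h hh => hT h hh N) r r' hr h
      rw [if_pos h]
      linarith
    · have := pair_bound F hF N R (fun h => τ h * N + C) (fun h hh => hT h hh N) r' r hr' h
      have e : ‖∑ n ∈ range N, F (n + r) * (starRingEnd ℂ) (F (n + r'))‖
         = ‖∑ n ∈ range N, F (n + r') * (starRingEnd ℂ) (F (n + r))‖ := by
        rw [← Complex.norm_conj, map_sum]
        congr 1
        refine Finset.sum_congr rfl fun n _ => ?_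
        simp [mul_comm]
      rw [e, if_pos h]
      linarith
  have h2 : ‖U‖ ^ 2 ≤ N * ∑ n ∈ range N, ‖∑ r ∈ range R, F (n + r)‖ ^ 2 := by
    calc ‖U‖ ^ 2 ≤ (∑ n ∈ range N, ‖∑ r ∈ range R, F (n + r)‖) ^ 2 := by
          gcongr; exact norm_sum_le _ _
      _ ≤ _ := by
          have := sq_sum_le_card_mul_sum_sq (s := range N) (f := fun n => ‖∑ r ∈ range R, F (n + r)‖)
          simpa using this
  have h3 : ((∑ n ∈ range N, ‖∑ r ∈ range R, F (n + r)‖ ^ 2 : ℝ) : ℂ)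
      = ∑ r ∈ range R, ∑ r' ∈ range R, ∑ n ∈ range N, F (n + r) * (starRingEnd ℂ) (F (n + r')) := by
    push_cast
    have : ∀ n ∈ range N, ((‖∑ r ∈ range R, F (n + r)‖ : ℂ)) ^ 2
       = ∑ r ∈ range R, ∑ r' ∈ range R, F (n + r) * (starRingEnd ℂ) (F (n + r')) := by
      intro n _
      rw [← Complex.mul_conj', map_sum, Finset.sum_mul_sum]
    rw [Finset.sum_congr rfl this, Finset.sum_comm]
    refine Finset.sum_congr rfl fun r _ => ?_
    rw [Finset.sum_comm]
  have h4 : ∑ n ∈ range N, ‖∑ r ∈ range R, F (n + r)‖ ^ 2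
      ≤ ∑ r ∈ range R, ∑ r' ∈ range R, ((if r' ≤ r then τ (r - r') else 0) * N + (if r ≤ r' then τ (r' - r) else 0) * N + (C + 2 * R)) := by
    have e : ∑ n ∈ range N, ‖∑ r ∈ range R, F (n + r)‖ ^ 2
       = ‖((∑ n ∈ range N, ‖∑ r ∈ range R, F (n + r)‖ ^ 2 : ℝ) : ℂ)‖ := by
      rw [Complex.norm_real, Real.norm_of_nonneg]
      positivity
    rw [e, h3]
    refine (norm_sum_le _ _).trans (Finset.sum_le_sum fun r hr => ?_)
    exact (norm_sum_le _ _).trans (Finset.sum_le_sum fun r' hr' => hpair r hr r' hr')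
  have h5 : ∑ r ∈ range R, ∑ r' ∈ range R, (if r' ≤ r then τ (r - r') else 0) ≤ R * (ε * R) := by
    have : ∀ r ∈ range R, ∑ r' ∈ range R, (if r' ≤ r then τ (r - r') else 0) ≤ ε * R := by
      intro r hr
      rw [Finset.mem_range] at hr
      refine le_trans ?_ hτ
      rw [← Finset.sum_filter]
      have e : (range R).filter (fun r' => r' ≤ r) = range (r + 1) := by
        ext x; simp; omega
      rw [e]
      have := Finset.sum_range_reflect τ (r + 1)
      simp only [Nat.add_sub_cancel] at this
      rw [this]
      exact Finset.sum_le_sum_of_subset_of_nonneg (by simpa using hr) (fun i _ _ => hτ0 i)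
    calc _ ≤ ∑ r ∈ range R, ε * R := Finset.sum_le_sum this
      _ = _ := by simp
  have h6 : ∑ r ∈ range R, ∑ r' ∈ range R, (if r ≤ r' then τ (r' - r) else 0) ≤ R * (ε * R) := by
    rw [Finset.sum_comm]; exact h5
  have h7 : ∑ n ∈ range N, ‖∑ r ∈ range R, F (n + r)‖ ^ 2
      ≤ 2 * (R * (ε * R)) * N + R ^ 2 * (C + 2 * R) := by
    refine h4.trans ?_
    simp only [Finset.sum_add_distrib, ← Finset.sum_mul]
    simp only [Finset.sum_const, Finset.card_range, nsmul_eq_mul]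
    have a1 := mul_le_mul_of_nonneg_right h5 hN
    have a2 := mul_le_mul_of_nonneg_right h6 hN
    nlinarith
  have h8 : ‖U‖ ^ 2 ≤ N * (2 * (R * (ε * R)) * N + R ^ 2 * (C + 2 * R)) :=
    h2.trans (mul_le_mul_of_nonneg_left h7 hN)
  have h9 : R * ‖S‖ ≤ ‖U‖ + 2 * R ^ 2 := by
    have := norm_le_norm_sub_add (R * S) U
    rw [norm_sub_rev, norm_mul, Complex.norm_natCast] at this
    linarith
  have h10 : (R * ‖S‖) ^ 2 ≤ 2 * ‖U‖ ^ 2 + 8 * R ^ 4 := by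
    have : (R * ‖S‖) ^ 2 ≤ (‖U‖ + 2 * R ^ 2) ^ 2 := by gcongr
    nlinarith [sq_nonneg (‖U‖ - 2 * R ^ 2)]
  have h11 : (R : ℝ) ^ 2 * ‖S‖ ^ 2
      ≤ R ^ 2 * (4 * ε * N ^ 2 + (2 * (C + 2 * R) * N + 8 * R ^ 2)) := by
    nlinarith
  have h12 := le_of_mul_le_mul_left h11 (by positivity)
  refine h12.trans ?_
  have : 0 ≤ 8 * (R : ℝ) ^ 2 * N := by positivity
  nlinarith

/-- strongly `q`-multiplicative unimodular function -/
structure StrMul (q : ℕ) (f : ℕ → ℂ) : Prop where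
  two_le : 2 ≤ q
  norm_one : ∀ n, ‖f n‖ = 1
  mul : ∀ n r, r < q → f (q * n + r) = f n * f r

lemma StrMul.zero {q : ℕ} {f : ℕ → ℂ} (h : StrMul q f) : f 0 = 1 := by
  have h1 := h.mul 0 0 (by have := h.two_le; omega)
  have h2 : f 0 ≠ 0 := by
    intro h0; have := h.norm_one 0; simp [h0] at this
  simp only [mul_zero, add_zero] at h1
  exact (mul_eq_left₀ h2).1 h1.symm

lemma StrMul.conj_mul {q : ℕ} {f : ℕ → ℂ} (h : StrMul q f) (n : ℕ) :
    f n * (starRingEnd ℂ) (f n) = 1 := by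
  rw [Complex.mul_conj', h.norm_one]; simp

lemma StrMul.pow_mul {q : ℕ} {f : ℕ → ℂ} (h : StrMul q f) (s : ℕ) :
    ∀ n r, r < q ^ s → f (q ^ s * n + r) = f n * f r := by
  have hq := h.two_le
  induction s with
  | zero => intro n r hr; simp at hr; simp [hr, h.zero]
  | succ s ih =>
    intro n r hr
    have h1 : r / q < q ^ s := by
      apply Nat.div_lt_of_lt_mul
      rw [pow_succ] at hr; linarith
    have h2 := Nat.mod_lt r (show 0 < q by omega)
    have h3 := Nat.div_add_mod r q
    have e : q ^ (s + 1) * n + r = q * (q ^ s * n + r / q) + r % q := by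
      rw [pow_succ]; nlinarith
    rw [e, h.mul _ _ h2, ih _ _ h1, mul_assoc, ← h.mul _ _ h2, h3]

lemma rec_bound {q : ℕ} {f : ℕ → ℂ} (h : StrMul q f) (s r u : ℕ) (hu : u < q) :
    ‖∑ n ∈ range (q ^ (s + 1)), corrD f (q * r + u) n‖
      ≤ ‖∑ j ∈ range (q - u), corrD f u j‖ * ‖∑ n ∈ range (q ^ s), corrD f r n‖
        + u * ‖∑ n ∈ range (q ^ s), corrD f (r + 1) n‖ := by
  have e : ∑ n ∈ range (q ^ (s + 1)), corrD f (q * r + u) n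
      = (∑ j ∈ range (q - u), corrD f u j) * (∑ n ∈ range (q ^ s), corrD f r n)
       + (∑ j ∈ range u, f j * (starRingEnd ℂ) (f (q - u + j))) *
          (∑ n ∈ range (q ^ s), corrD f (r + 1) n) := by
    rw [pow_succ, block_sum, Finset.sum_mul_sum, Finset.sum_mul_sum]
    rw [Finset.sum_comm (s := range (q - u)), Finset.sum_comm (s := range u),
      ← Finset.sum_add_distrib]
    refine Finset.sum_congr rfl fun n _ => ?_
    conv_lhs => rw [show q = (q - u) + u by omega, Finset.sum_range_add]
    rw [show (q - u) + u = q by omega]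
    congr 1
    · refine Finset.sum_congr rfl fun j hj => ?_
      rw [Finset.mem_range] at hj
      unfold corrD
      rw [show q * n + j + (q * r + u) = q * (n + r) + (j + u) by ring,
        h.mul _ _ (by omega), h.mul _ _ (by omega), map_mul]
      ring
    · refine Finset.sum_congr rfl fun j hj => ?_
      rw [Finset.mem_range] at hj
      unfold corrD
      rw [show q * n + (q - u + j) + (q * r + u) = q * (n + (r + 1)) + j by
            have : q - u + u = q := by omega
            nlinarith,
        h.mul _ _ (by omega), h.mul _ _ (by omega), map_mul]
      ring
  rw [e]
  refine (norm_add_le _ _).trans ?_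
  rw [norm_mul, norm_mul]
  gcongr
  refine (norm_sum_le _ _).trans ?_
  simp [h.norm_one]

lemma norm_corr_sum_le {q : ℕ} {f : ℕ → ℂ} (h : StrMul q f) (r N : ℕ) :
    ‖∑ n ∈ range N, corrD f r n‖ ≤ N := by
  refine (norm_sum_le _ _).trans ?_
  simp [corrD_norm h.norm_one]

lemma strict_one {q : ℕ} {f : ℕ → ℂ} (h : StrMul q f) (j : ℕ) (hj : 0 < j) (hjq : j + 1 < q)
    (hne : corrD f 1 j ≠ corrD f 1 0) :
    ‖∑ j ∈ range (q - 1), corrD f 1 j‖ < (q - 1 : ℕ) := by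
  have hn := corrD_norm h.norm_one
  have m0 : 0 ∈ range (q - 1) := by simp; omega
  have mj : j ∈ (range (q - 1)).erase 0 := by simp; omega
  rw [← Finset.add_sum_erase _ _ m0, ← Finset.add_sum_erase _ _ mj, ← add_assoc]
  have h1 : ‖corrD f 1 0 + corrD f 1 j‖ < 2 := by
    refine lt_of_le_of_ne ((norm_add_le _ _).trans (by rw [hn, hn]; norm_num)) fun h2 => ?_
    exact hne (eq_of_norm_eq_of_norm_add_eq (by rw [hn, hn]) (by rw [h2, hn, hn]; norm_num)).symm
  have h2 : ‖∑ x ∈ ((range (q - 1)).erase 0).erase j, corrD f 1 x‖ ≤ (q - 3 : ℕ) := by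
    refine (norm_sum_le _ _).trans ?_
    simp only [hn, Finset.sum_const, nsmul_eq_mul, mul_one]
    rw [Finset.card_erase_of_mem mj, Finset.card_erase_of_mem m0, Finset.card_range]
    exact_mod_cast (by omega)
  have h3 : ((q - 1 : ℕ) : ℝ) = (q - 3 : ℕ) + 2 := by exact_mod_cast (by omega)
  have := norm_add_le (corrD f 1 0 + corrD f 1 j)
    (∑ x ∈ ((range (q - 1)).erase 0).erase j, corrD f 1 x)
  linarith

lemma W_rec {q : ℕ} {f : ℕ → ℂ} (h : StrMul q f) (j : ℕ) (hj : 0 < j) (hjq : j + 1 < q)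
    (hne : corrD f 1 j ≠ corrD f 1 0) :
    ∃ c : ℝ, 0 ≤ c ∧ c < 1 ∧ ∀ s R : ℕ,
      ∑ r ∈ range (R * q), ‖∑ n ∈ range (q ^ (s + 1)), corrD f r n‖
        ≤ c * q ^ 2 * (∑ r ∈ range R, ‖∑ n ∈ range (q ^ s), corrD f r n‖) + q ^ 2 * q ^ s := by
  have hq : (0 : ℝ) < q := by have := h.two_le; positivity
  set α := ∑ u ∈ range q, ‖∑ j ∈ range (q - u), corrD f u j‖ with hα
  set β := ∑ u ∈ range q, (u : ℝ) with hβ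
  have hβ0 : 0 ≤ β := Finset.sum_nonneg fun _ _ => by positivity
  have hα0 : 0 ≤ α := Finset.sum_nonneg fun _ _ => by positivity
  have hlt : α + β < q ^ 2 := by
    rw [hα, hβ, ← Finset.sum_add_distrib]
    have : ∑ u ∈ range q, (q : ℝ) = q ^ 2 := by simp; ring
    rw [← this]
    apply Finset.sum_lt_sum
    · intro u hu
      rw [Finset.mem_range] at hu
      have := norm_corr_sum_le h u (q - u)
      rw [Nat.cast_sub hu.le] at this
      linarith
    · refine ⟨1, by simp; omega, ?_⟩
      have := strict_one h j hj hjq hne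
      rw [Nat.cast_sub (by omega)] at this
      linarith
  refine ⟨(α + β) / q ^ 2, by positivity, by rw [div_lt_one (by positivity)]; exact hlt, ?_⟩
  intro s R
  rw [div_mul_cancel₀ _ (by positivity), block_sum]
  set S : ℕ → ℝ := fun r => ‖∑ n ∈ range (q ^ s), corrD f r n‖ with hS
  have hS0 : ∀ r, 0 ≤ S r := fun r => norm_nonneg _
  have hS1 : ∀ r, S r ≤ q ^ s := fun r => by
    have := norm_corr_sum_le h r (q ^ s)
    push_cast at this; exact this
  calc _ ≤ ∑ r ∈ range R, (α * S r + β * S (r + 1)) := by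
        refine Finset.sum_le_sum fun r _ => ?_
        rw [hα, hβ, Finset.sum_mul, Finset.sum_mul, ← Finset.sum_add_distrib]
        exact Finset.sum_le_sum fun u hu => rec_bound h s r u (Finset.mem_range.1 hu)
    _ = α * ∑ r ∈ range R, S r + β * ∑ r ∈ range R, S (r + 1) := by
        rw [Finset.sum_add_distrib, Finset.mul_sum, Finset.mul_sum]
    _ ≤ α * ∑ r ∈ range R, S r + β * (∑ r ∈ range R, S r + q ^ s) := by
        gcongr
        have e1 := Finset.sum_range_succ S R
        have e2 := Finset.sum_range_succ' S R
        have := hS0 0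
        have := hS1 R
        linarith
    _ ≤ _ := by
        have : β * (q : ℝ) ^ s ≤ q ^ 2 * q ^ s := by
          gcongr; linarith
        linarith

lemma W_small {q : ℕ} {f : ℕ → ℂ} (h : StrMul q f) (j : ℕ) (hj : 0 < j) (hjq : j + 1 < q)
    (hne : corrD f 1 j ≠ corrD f 1 0) (ε : ℝ) (hε : 0 < ε) :
    ∃ R : ℕ, 0 < R ∧ ∃ s0 : ℕ, ∀ s ≥ s0,
      ∑ r ∈ range R, ‖∑ n ∈ range (q ^ s), corrD f r n‖ ≤ ε * R * q ^ s := by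
  obtain ⟨c, hc0, hc1, hrec⟩ := W_rec h j hj hjq hne
  have hq2 : (2 : ℝ) ≤ q := by exact_mod_cast h.two_le
  have hq : (0 : ℝ) < q := by linarith
  set d := max c (1 / q) with hd
  have hd1 : d < 1 := max_lt hc1 (by rw [div_lt_one hq]; linarith)
  have hd0 : 0 < d := lt_of_lt_of_le (by positivity) (le_max_right _ _)
  have hdc : c ≤ d := le_max_left _ _
  have hdq : 1 ≤ d * q := by
    have : 1 / (q : ℝ) ≤ d := le_max_right _ _
    rwa [div_le_iff₀ hq] at this
  have key : ∀ t s' : ℕ, d * ∑ r ∈ range (q ^ t), ‖∑ n ∈ range (q ^ (t + s')), corrD f r n‖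
      ≤ (t + 1) * d ^ t * q ^ t * q ^ (t + s') := by
    intro t
    induction t with
    | zero =>
      intro s'
      have := norm_corr_sum_le h 0 (q ^ (0 + s'))
      push_cast at this
      simp only [pow_zero, Finset.sum_range_one]
      have h0 := norm_nonneg (∑ n ∈ range (q ^ (0 + s')), corrD f 0 n)
      push_cast
      nlinarith
    | succ t ih =>
      intro s'
      have i1 := ih s'
      have i2 := hrec (t + s') (q ^ t)
      rw [show t + 1 + s' = t + s' + 1 by ring, pow_succ q t]
      set W := ∑ r ∈ range (q ^ t), ‖∑ n ∈ range (q ^ (t + s')), corrD f r n‖ with hW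
      have hW0 : 0 ≤ W := Finset.sum_nonneg fun _ _ => norm_nonneg _
      set A : ℝ := (q : ℝ) ^ (t + s') with hA
      have hA0 : 0 ≤ A := by positivity
      have i3 : d * (c * q ^ 2 * W) ≤ d * q ^ 2 * ((t + 1) * d ^ t * q ^ t * A) := by
        calc d * (c * q ^ 2 * W) = c * q ^ 2 * (d * W) := by ring
          _ ≤ d * q ^ 2 * ((t + 1) * d ^ t * q ^ t * A) := by gcongr
      have i4 : d * (q ^ 2 * A) ≤ d * (q ^ 2 * A) * (d * q) ^ t :=
        le_mul_of_one_le_right (by positivity) (one_le_pow₀ hdq)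
      have i5 := mul_le_mul_of_nonneg_left i2 hd0.le
      refine i5.trans ?_
      rw [mul_add]
      refine (add_le_add i3 i4).trans (le_of_eq ?_)
      rw [pow_succ (q : ℝ) (t + s'), ← hA]
      push_cast
      rw [mul_pow]
      ring
  have lim : Filter.Tendsto (fun t : ℕ => ((t : ℝ) + 1) * d ^ t) Filter.atTop (nhds 0) := by
    have l1 := tendsto_self_mul_const_pow_of_lt_one hd0.le hd1
    have l2 := tendsto_pow_atTop_nhds_zero_of_lt_one hd0.le hd1
    have := l1.add l2
    simpa [add_mul] using this
  obtain ⟨t, ht⟩ := (lim.eventually (gt_mem_nhds (show 0 < d * ε by positivity))).exists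
  refine ⟨q ^ t, pow_pos (by have := h.two_le; omega) _, t, fun s hs => ?_⟩
  obtain ⟨s', rfl⟩ := Nat.exists_eq_add_of_le hs
  have k1 := key t s'
  have k2 : ((t : ℝ) + 1) * d ^ t * q ^ t * q ^ (t + s') ≤ d * ε * q ^ t * q ^ (t + s') := by
    gcongr
  have k3 := k1.trans k2
  push_cast
  refine le_of_mul_le_mul_left (k3.trans (le_of_eq ?_)) hd0
  ring

lemma corrD_periodic {q : ℕ} {f : ℕ → ℂ} (h : StrMul q f) (s r n : ℕ)
    (hn : n % q ^ s + r < q ^ s) : corrD f r n = corrD f r (n % q ^ s) := by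
  have hq : 0 < q ^ s := pow_pos (by have := h.two_le; omega) _
  have h1 := Nat.div_add_mod n (q ^ s)
  have h2 := Nat.mod_lt n hq
  unfold corrD
  conv_lhs => rw [← h1]
  rw [add_assoc, h.pow_mul s _ _ hn, h.pow_mul s _ _ h2, map_mul]
  linear_combination f (n % q ^ s + r) * (starRingEnd ℂ) (f (n % q ^ s)) * h.conj_mul (n / q ^ s)

lemma bad_sum (M A r : ℕ) (hM : 0 < M) :
    ∑ n ∈ range (A * M), (if n % M + r < M then (0 : ℝ) else 1) ≤ A * r := by
  rw [block_sum]
  have : ∀ y ∈ range A, ∑ x ∈ range M, (if (M * y + x) % M + r < M then (0 : ℝ) else 1) ≤ r := by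
    intro y _
    have e : ∀ x ∈ range M, (if (M * y + x) % M + r < M then (0 : ℝ) else 1)
        = if ¬ (x + r < M) then 1 else 0 := by
      intro x hx
      rw [Nat.mul_add_mod, Nat.mod_eq_of_lt (Finset.mem_range.1 hx)]
      split_ifs <;> simp_all
    rw [Finset.sum_congr rfl e, ← Finset.sum_filter]
    simp only [Finset.sum_const, nsmul_eq_mul, mul_one]
    have : (range M).filter (fun x => ¬ (x + r < M)) ⊆ Finset.Ico (M - r) M := by
      intro x hx
      simp at hx ⊢
      omega
    have := Finset.card_le_card this
    rw [Nat.card_Ico] at this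
    exact_mod_cast (by omega)
  calc _ ≤ ∑ y ∈ range A, (r : ℝ) := Finset.sum_le_sum this
    _ = _ := by simp

lemma periodic_sum (K M Q : ℕ) (hM : 0 < M) (hc : Nat.Coprime M Q)
    (g G : ℕ → ℂ) (hg : ∀ n, g (n % M) = g n) (hG : ∀ n, G (n % Q) = G n) (hG1 : ∀ n, ‖G n‖ ≤ 1) :
    ‖∑ n ∈ range (K * (M * Q)), g n * G n‖ ≤ K * Q * ‖∑ n ∈ range M, g n‖ := by
  have key : ∀ x₀, ∑ n ∈ range (M * Q), g (M * Q * x₀ + n) * G (M * Q * x₀ + n)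
      = (∑ n ∈ range M, g n) * ∑ x ∈ range Q, G x := by
    intro x₀
    rw [block_sum, Finset.sum_comm, Finset.mul_sum]
    refine Finset.sum_congr rfl fun x _ => ?_
    rw [← coprime_sum M Q x hM hc g hg, Finset.sum_mul]
    refine Finset.sum_congr rfl fun y _ => ?_
    congr 1
    · rw [← hg, mul_assoc, Nat.mul_add_mod, hg]
    · rw [← hG, ← hG x]
      congr 1
      rw [show M * Q * x₀ + (Q * y + x) = Q * (M * x₀ + y) + x by ring, Nat.mul_add_mod]
  rw [block_sum, Finset.sum_congr rfl fun x _ => key x]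
  simp only [Finset.sum_const, Finset.card_range, nsmul_eq_mul, norm_mul, Complex.norm_natCast]
  have : ‖∑ x ∈ range Q, G x‖ ≤ Q := by
    refine (norm_sum_le _ _).trans ((Finset.sum_le_sum fun n _ => hG1 n).trans ?_)
    simp
  calc _ ≤ (K : ℝ) * (‖∑ n ∈ range M, g n‖ * Q) := by gcongr
    _ = _ := by ring

lemma corr_est {k : ℕ} (q : Fin k → ℕ) (f : Fin k → ℕ → ℂ) (h : ∀ i, StrMul (q i) (f i))
    (hcop : ∀ i j, i ≠ j → Nat.Coprime (q i) (q j)) (i0 : Fin k) (r s N : ℕ) :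
    ‖∑ n ∈ range N, corrD (fun n => ∏ i, f i n) r n‖
      ≤ (‖∑ n ∈ range (q i0 ^ s), corrD (f i0) r n‖ / q i0 ^ s + 2 * k * r / 2 ^ s) * N
        + (∏ i, q i ^ s : ℕ) := by
  set M : Fin k → ℕ := fun i => q i ^ s with hMdef
  have hM0 : ∀ i, 0 < M i := fun i => pow_pos (by have := (h i).two_le; omega) _
  set P := ∏ i, M i with hP
  have hP0 : 0 < P := Finset.prod_pos fun i _ => hM0 i
  set K := N / P with hK
  have hN : K * P + N % P = N := by rw [mul_comm]; exact Nat.div_add_mod N P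
  have hmod := Nat.mod_lt N hP0
  have hKP : (K : ℝ) * P ≤ N := by exact_mod_cast (by omega : K * P ≤ N)
  set F : ℕ → ℂ := fun n => ∏ i, f i n with hF
  have hD : ∀ n, corrD F r n = ∏ i, corrD (f i) r n := by
    intro n; simp [corrD, hF, map_prod, Finset.prod_mul_distrib]
  have hD1 : ∀ n, ‖corrD F r n‖ = 1 := by
    intro n; rw [hD, norm_prod]; simp [corrD_norm (h _).norm_one]
  set g : Fin k → ℕ → ℂ := fun i n => corrD (f i) r (n % M i) with hg
  have hg1 : ∀ i n, ‖g i n‖ = 1 := fun i n => corrD_norm (h i).norm_one _ _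
  have hdiff : ∀ n, ‖corrD F r n - ∏ i, g i n‖
      ≤ 2 * ∑ i, (if n % M i + r < M i then (0 : ℝ) else 1) := by
    intro n
    by_cases hb : ∀ i, n % M i + r < M i
    · have : corrD F r n = ∏ i, g i n := by
        rw [hD]
        exact Finset.prod_congr rfl fun i _ => corrD_periodic (h i) s r n (hb i)
      rw [this]
      simp [hb]
    · push Not at hb
      obtain ⟨i, hi⟩ := hb
      have h1 : (1 : ℝ) ≤ ∑ i, (if n % M i + r < M i then (0 : ℝ) else 1) := by
        have := Finset.single_le_sum (f := fun i => (if n % M i + r < M i then (0 : ℝ) else 1))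
          (fun i _ => by split_ifs <;> simp) (Finset.mem_univ i)
        simpa [not_lt.2 hi] using this
      have h2 := norm_sub_le (corrD F r n) (∏ i, g i n)
      rw [hD1, norm_prod] at h2
      simp only [hg1, Finset.prod_const_one] at h2
      linarith
  have hPi : ∀ i, P = (∏ j ∈ univ.erase i, M j) * M i := fun i =>
    (Finset.prod_erase_mul _ _ (Finset.mem_univ i)).symm
  have hbad : ∀ i, ∑ n ∈ range (K * P), (if n % M i + r < M i then (0 : ℝ) else 1)
      ≤ N * r / 2 ^ s := by
    intro i
    have h1 := bad_sum (M i) (K * ∏ j ∈ univ.erase i, M j) r (hM0 i)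
    rw [mul_assoc, ← hPi i] at h1
    refine h1.trans ?_
    rw [le_div_iff₀ (by positivity)]
    have h2 : (2 : ℝ) ^ s ≤ M i := by
      simp only [hMdef]; push_cast
      have : (2 : ℝ) ≤ q i := by exact_mod_cast (h i).two_le
      gcongr
    calc ((K * ∏ j ∈ univ.erase i, M j : ℕ) : ℝ) * r * 2 ^ s
        ≤ ((K * ∏ j ∈ univ.erase i, M j : ℕ) : ℝ) * r * M i := by gcongr
      _ = (K * P : ℝ) * r := by rw [hPi i]; push_cast; ring
      _ ≤ N * r := by gcongr
  have hmain : ‖∑ n ∈ range (K * P), ∏ i, g i n‖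
      ≤ N * (‖∑ n ∈ range (q i0 ^ s), corrD (f i0) r n‖ / q i0 ^ s) := by
    set Q := ∏ j ∈ univ.erase i0, M j with hQ
    have hc : Nat.Coprime (M i0) Q := by
      refine Nat.Coprime.prod_right fun j hj => ?_
      exact Nat.Coprime.pow _ _ (hcop _ _ (Finset.ne_of_mem_erase hj).symm)
    have := periodic_sum K (M i0) Q (hM0 i0) hc (g i0) (fun n => ∏ j ∈ univ.erase i0, g j n)
      (fun n => by simp [hg]) (fun n => by
        refine Finset.prod_congr rfl fun j hj => ?_
        simp only [hg]
        rw [Nat.mod_mod_of_dvd _ (Finset.dvd_prod_of_mem _ hj)])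
      (fun n => by rw [norm_prod]; simp [hg1])
    rw [mul_comm (M i0) Q, ← hPi i0] at this
    have e0 : ∀ n, g i0 n * ∏ j ∈ univ.erase i0, g j n = ∏ i, g i n := fun n =>
      Finset.mul_prod_erase univ (fun i => g i n) (Finset.mem_univ i0)
    simp only [e0] at this
    have e : ∑ n ∈ range (M i0), g i0 n = ∑ n ∈ range (M i0), corrD (f i0) r n := by
      refine Finset.sum_congr rfl fun n hn => ?_
      simp only [hg]
      rw [Nat.mod_eq_of_lt (Finset.mem_range.1 hn)]
    rw [e] at this
    refine this.trans ?_
    have hMr : (0 : ℝ) < (q i0 : ℝ) ^ s := by exact_mod_cast hM0 i0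
    rw [mul_div_assoc', le_div_iff₀ hMr]
    have e2 : (K : ℝ) * P = K * Q * (q i0 : ℝ) ^ s := by
      have hMc : ((M i0 : ℕ) : ℝ) = (q i0 : ℝ) ^ s := by simp [hMdef]
      rw [hPi i0, Nat.cast_mul, hMc, ← hQ]; ring
    calc _ = (K * Q * (q i0 : ℝ) ^ s) * ‖∑ n ∈ range (M i0), corrD (f i0) r n‖ := by ring
      _ ≤ _ := by rw [← e2]; gcongr
  have htail : ‖∑ x ∈ range (N % P), corrD F r (K * P + x)‖ ≤ P := by
    refine (norm_sum_le _ _).trans ?_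
    simp only [hD1, Finset.sum_const, Finset.card_range, nsmul_eq_mul, mul_one]
    exact_mod_cast hmod.le
  have hhead : ‖∑ n ∈ range (K * P), corrD F r n‖
      ≤ N * (‖∑ n ∈ range (q i0 ^ s), corrD (f i0) r n‖ / q i0 ^ s) + 2 * (k * (N * r / 2 ^ s)) := by
    have h1 := norm_le_norm_add_norm_sub' (∑ n ∈ range (K * P), corrD F r n)
      (∑ n ∈ range (K * P), ∏ i, g i n)
    have h2 : ‖∑ n ∈ range (K * P), corrD F r n - ∑ n ∈ range (K * P), ∏ i, g i n‖
        ≤ 2 * (k * (N * r / 2 ^ s)) := by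
      rw [← Finset.sum_sub_distrib]
      refine (norm_sum_le _ _).trans ((Finset.sum_le_sum fun n _ => hdiff n).trans ?_)
      rw [← Finset.mul_sum, Finset.sum_comm]
      have := Finset.sum_le_sum fun i (_ : i ∈ (univ : Finset (Fin k))) => hbad i
      simp only [Finset.sum_const, Finset.card_univ, Fintype.card_fin, nsmul_eq_mul] at this
      linarith
    linarith
  have hsplit : ∑ n ∈ range N, corrD F r n
      = ∑ n ∈ range (K * P), corrD F r n + ∑ x ∈ range (N % P), corrD F r (K * P + x) := by
    rw [← Finset.sum_range_add, hN]
  rw [hsplit]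
  refine (norm_add_le _ _).trans ((add_le_add hhead htail).trans (le_of_eq ?_))
  ring

lemma core {k : ℕ} (q : Fin k → ℕ) (f : Fin k → ℕ → ℂ) (h : ∀ i, StrMul (q i) (f i))
    (hcop : ∀ i j, i ≠ j → Nat.Coprime (q i) (q j)) (i0 : Fin k)
    (j : ℕ) (hj : 0 < j) (hjq : j + 1 < q i0)
    (hne : corrD (f i0) 1 j ≠ corrD (f i0) 1 0) :
    Filter.Tendsto (fun N : ℕ => (∑ n ∈ range N, ∏ i, f i n) / (N : ℂ)) Filter.atTop (nhds 0) := by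
  set F : ℕ → ℂ := fun n => ∏ i, f i n with hF
  have hF1 : ∀ n, ‖F n‖ = 1 := by
    intro n; simp [hF, norm_prod, (h _).norm_one]
  have est : ∀ ε > 0, ∃ C' : ℝ, ∀ N : ℕ,
      ‖∑ n ∈ range N, F n‖ ^ 2 ≤ 4 * ε * N ^ 2 + C' * (N + 1) := by
    intro ε hε
    obtain ⟨R, hR, s0, hs0⟩ := W_small (h i0) j hj hjq hne (ε / 2) (by positivity)
    have hR' : (0 : ℝ) < R := by exact_mod_cast hR
    have lim : Filter.Tendsto (fun s : ℕ => 2 * k * R * (1 / 2 : ℝ) ^ s) Filter.atTop (nhds 0) := by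
      have := (tendsto_pow_atTop_nhds_zero_of_lt_one (r := (1 / 2 : ℝ)) (by norm_num)
        (by norm_num)).const_mul (2 * k * R : ℝ)
      simpa using this
    obtain ⟨s, hs, hss⟩ := ((lim.eventually (gt_mem_nhds (show 0 < ε / 2 by positivity))).and
      (Filter.eventually_ge_atTop s0)).exists
    have hqs : (0 : ℝ) < (q i0 : ℝ) ^ s := by
      have := (h i0).two_le; positivity
    refine vdc F hF1 R hR
      (fun r => ‖∑ n ∈ range (q i0 ^ s), corrD (f i0) r n‖ / q i0 ^ s + 2 * k * r / 2 ^ s)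
      ((∏ i, q i ^ s : ℕ)) ε (by positivity) (fun r => by positivity) ?_
      (fun r _ N => corr_est q f h hcop i0 r s N)
    rw [Finset.sum_add_distrib, ← Finset.sum_div]
    have a1 : (∑ r ∈ range R, ‖∑ n ∈ range (q i0 ^ s), corrD (f i0) r n‖) / (q i0 : ℝ) ^ s
        ≤ ε / 2 * R := by
      rw [div_le_iff₀ hqs]; exact hs0 s hss
    have a2 : ∑ r ∈ range R, 2 * k * (r : ℝ) / 2 ^ s ≤ ∑ r ∈ range R, ε / 2 := by
      refine Finset.sum_le_sum fun r hr => ?_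
      refine le_trans ?_ hs.le
      have : (r : ℝ) ≤ R := by exact_mod_cast (Finset.mem_range.1 hr).le
      rw [one_div_pow, mul_one_div]
      gcongr
    simp only [Finset.sum_const, Finset.card_range, nsmul_eq_mul] at a2
    linarith
  rw [Metric.tendsto_atTop]
  intro δ hδ
  obtain ⟨C', hC'⟩ := est (δ ^ 2 / 8) (by positivity)
  obtain ⟨N0, hN0⟩ := exists_nat_gt (4 * |C'| / δ ^ 2 + 1)
  refine ⟨N0, fun N hN => ?_⟩
  have hNr : (N0 : ℝ) ≤ N := by exact_mod_cast hN
  have hpos : 0 ≤ 4 * |C'| / δ ^ 2 := by positivity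
  have hN1 : (1 : ℝ) < N := by linarith
  rw [dist_zero_right, norm_div, Complex.norm_natCast, div_lt_iff₀ (by linarith)]
  refine lt_of_pow_lt_pow_left₀ 2 (by positivity) ((hC' N).trans_lt ?_)
  have b1 : 4 * |C'| < δ ^ 2 * N := by
    have : 4 * |C'| / δ ^ 2 < N := by linarith
    rw [div_lt_iff₀ (by positivity)] at this
    linarith
  have b2 : C' * (N + 1) ≤ |C'| * (2 * N) := by
    have := le_abs_self C'
    have := abs_nonneg C'
    nlinarith
  nlinarith

lemma fexp_mul_add (p : ℕ) (hp : p.Prime) (n r : ℕ) (hr : r < p) :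
    factorialExp p (p * n + r) = n + factorialExp p n := by
  have : Fact p.Prime := ⟨hp⟩
  unfold factorialExp
  rw [Nat.factorization_def _ hp, Nat.factorization_def _ hp, padicValNat_factorial_mul_add _ hr,
    padicValNat_factorial_mul, add_comm]

lemma fexp_lt (p : ℕ) (n : ℕ) (hn : n < p) : factorialExp p n = 0 :=
  Nat.factorization_factorial_eq_zero_of_lt hn

lemma fexp_pow (p : ℕ) (hp : p.Prime) (T : ℕ) : ∀ n r, r < p ^ T →
    factorialExp p (p ^ T * n + r)
      = (∑ j ∈ range T, p ^ j) * n + factorialExp p n + factorialExp p r := by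
  induction T with
  | zero =>
    intro n r hr
    simp at hr
    simp [hr, fexp_lt p 0 hp.pos]
  | succ T ih =>
    intro n r hr
    have h1 : r / p < p ^ T := by
      apply Nat.div_lt_of_lt_mul
      rw [pow_succ] at hr; linarith
    have h2 := Nat.mod_lt r hp.pos
    have h3 := Nat.div_add_mod r p
    have e : p ^ (T + 1) * n + r = p * (p ^ T * n + r / p) + r % p := by
      rw [pow_succ]; nlinarith
    have e2 : factorialExp p r = r / p + factorialExp p (r / p) := by
      conv_lhs => rw [← h3]
      rw [fexp_mul_add p hp _ _ h2]
    rw [e, fexp_mul_add p hp _ _ h2, ih _ _ h1, e2, Finset.sum_range_succ]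
    ring

lemma exists_T (p m : ℕ) (hp : p.Prime) (hm : 2 ≤ m) (hpm : ¬ p ∣ m) :
    ∃ T, 2 ≤ T ∧ m ∣ ∑ j ∈ range T, p ^ j := by
  have hp2 := hp.two_le
  have hc : Nat.Coprime p (m * (p - 1)) := by
    refine Nat.Coprime.mul_right ((Nat.Prime.coprime_iff_not_dvd hp).2 hpm) ?_
    refine (Nat.Prime.coprime_iff_not_dvd hp).2 fun hd => ?_
    have := Nat.le_of_dvd (by omega) hd
    omega
  have hpos : 0 < m * (p - 1) := Nat.mul_pos (by omega) (by omega)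
  have ht := Nat.totient_pos.2 hpos
  refine ⟨2 * (m * (p - 1)).totient, by omega, ?_⟩
  have h1 := (Nat.ModEq.pow_totient hc).pow 2
  rw [one_pow, ← pow_mul, mul_comm _ 2] at h1
  have h2 := (Nat.modEq_iff_dvd' (Nat.one_le_pow _ _ hp.pos)).1 h1.symm
  have h3 := Nat.geomSum_eq hp2 (2 * (m * (p - 1)).totient)
  rw [h3]
  exact Nat.dvd_div_of_mul_dvd (by rw [mul_comm (p - 1) m]; exact h2)

lemma strMul_fexp (p m T : ℕ) (hp : p.Prime) (hT : 2 ≤ T) (hd : m ∣ ∑ j ∈ range T, p ^ j)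
    (hm : 2 ≤ m) (z : ℂ) (hz : z ^ m = 1) : StrMul (p ^ T) (fun n => z ^ factorialExp p n) where
  two_le := hp.two_le.trans (Nat.le_self_pow (by omega) p)
  norm_one n := by
    rw [norm_pow, Complex.norm_eq_one_of_pow_eq_one hz (by omega), one_pow]
  mul n r hr := by
    obtain ⟨c, hc⟩ := hd
    rw [fexp_pow p hp T n r hr, hc, pow_add, pow_add, mul_assoc m, pow_mul, hz, one_pow, one_mul]

lemma weyl (k : ℕ) (p m : Fin k → ℕ)
    (hp : ∀ i, (p i).Prime) (hpdist : Function.Injective p)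
    (hm : ∀ i, 2 ≤ m i) (hpm : ∀ i, ¬ p i ∣ m i) (z : Fin k → ℂ) (hz : ∀ i, z i ^ m i = 1)
    (i0 : Fin k) (hi0 : z i0 ≠ 1) :
    Filter.Tendsto (fun N : ℕ => (∑ n ∈ range N, ∏ i, z i ^ factorialExp (p i) n) / (N : ℂ))
      Filter.atTop (nhds 0) := by
  choose T hT hTd using fun i => exists_T (p i) (m i) (hp i) (hm i) (hpm i)
  have hp2 := (hp i0).two_le
  refine core (fun i => p i ^ T i) (fun i n => z i ^ factorialExp (p i) n)
    (fun i => strMul_fexp (p i) (m i) (T i) (hp i) (hT i) (hTd i) (hm i) (z i) (hz i)) ?_ i0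
    (p i0 - 1) (by omega) ?_ ?_
  · intro i j hij
    exact Nat.Coprime.pow _ _ ((Nat.coprime_primes (hp i) (hp j)).2 fun e => hij (hpdist e))
  · have h1 : p i0 ^ 2 ≤ p i0 ^ T i0 := Nat.pow_le_pow_right (by omega) (hT i0)
    have : p i0 - 1 + 1 = p i0 := by omega
    simp only [this]
    nlinarith
  · have e : factorialExp (p i0) (p i0) = 1 := by
      have := fexp_mul_add (p i0) (hp i0) 1 0 (by omega)
      rw [fexp_lt (p i0) 1 (by omega)] at this
      simpa using this
    simp only [corrD]
    rw [show p i0 - 1 + 1 = p i0 by omega, e, fexp_lt (p i0) (p i0 - 1) (by omega), zero_add,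
      fexp_lt (p i0) 1 (by omega), fexp_lt (p i0) 0 (by omega)]
    simpa using hi0

lemma char_sum (m e a : ℕ) (hm : 2 ≤ m) (ha : a ≤ m - 1) (ζ : ℂ) (hζ : IsPrimitiveRoot ζ m) :
    (if e ≡ a [MOD m] then (1 : ℂ) else 0)
      = ∑ t ∈ range m, (1 / m : ℂ) * ((ζ ^ t) ^ (m - a) * (ζ ^ t) ^ e) := by
  have hm0 : (m : ℂ) ≠ 0 := by exact_mod_cast (by omega : m ≠ 0)
  have h1 : ∀ t ∈ range m, (1 / m : ℂ) * ((ζ ^ t) ^ (m - a) * (ζ ^ t) ^ e)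
      = (1 / m : ℂ) * (ζ ^ (m - a + e)) ^ t := by
    intro t _
    rw [← pow_add, ← pow_mul, ← pow_mul, mul_comm t]
  rw [Finset.sum_congr rfl h1, ← Finset.mul_sum]
  have hiff : e ≡ a [MOD m] ↔ m ∣ (m - a + e) := by
    rw [← Nat.modEq_zero_iff_dvd]
    constructor
    · intro h
      have := h.add_left (m - a)
      rw [show m - a + a = m by omega] at this
      exact this.trans (by simp [Nat.ModEq])
    · intro h
      have := h.add_right a
      rw [show m - a + e + a = e + m by omega, zero_add] at this
      simpa [Nat.ModEq] using this
  by_cases h : e ≡ a [MOD m]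
  · rw [if_pos h, (hζ.pow_eq_one_iff_dvd _).2 (hiff.1 h)]
    simp [hm0]
  · rw [if_neg h]
    have hne : ζ ^ (m - a + e) ≠ 1 := fun h' => h (hiff.2 ((hζ.pow_eq_one_iff_dvd _).1 h'))
    rw [geom_sum_eq hne, ← pow_mul, mul_comm (m - a + e) m, pow_mul, hζ.pow_eq_one]
    simp

open scoped Classical in
/-- For distinct primes `p₁,…,p_k`, moduli `m₁,…,m_k ≥ 2` with
`pᵢ ∤ mᵢ`, and residues `0 ≤ aᵢ ≤ mᵢ - 1`, the count of `0 ≤ n < N` with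
`e_{pᵢ}(n) ≡ aᵢ (mod mᵢ)` for all `i` is asymptotic to `N/(m₁⋯m_k)` as `N → ∞`. -/
theorem stmt_1 (k : ℕ) (hk : 0 < k) (p m : Fin k → ℕ)
    (hp : ∀ i, (p i).Prime) (hpdist : Function.Injective p)
    (hm : ∀ i, 2 ≤ m i) (hpm : ∀ i, ¬ p i ∣ m i)
    (a : Fin k → ℕ) (ha : ∀ i, a i ≤ m i - 1) :
    Filter.Tendsto
      (fun N : ℕ =>
        (((Finset.range N).filter
            (fun n => ∀ i, factorialExp (p i) n ≡ a i [MOD m i])).card : ℝ) /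
          ((N : ℝ) / ∏ i, (m i : ℝ)))
      Filter.atTop (nhds 1) := by
  have hm0 : ∀ i, (m i : ℂ) ≠ 0 := fun i => by
    have := hm i; exact_mod_cast (by omega : m i ≠ 0)
  set ζ : Fin k → ℂ := fun i => Complex.exp (2 * Real.pi * Complex.I / m i) with hζdef
  have hζ : ∀ i, IsPrimitiveRoot (ζ i) (m i) := fun i =>
    Complex.isPrimitiveRoot_exp (m i) (by have := hm i; omega)
  set c : (Fin k → ℕ) → ℂ := fun t => ∏ i, ((1 / m i : ℂ) * (ζ i ^ t i) ^ (m i - a i)) with hc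
  set Φ := Fintype.piFinset fun i => range (m i) with hΦ
  have hcount : ∀ N : ℕ, (((Finset.range N).filter
      (fun n => ∀ i, factorialExp (p i) n ≡ a i [MOD m i])).card : ℂ)
      = ∑ t ∈ Φ, c t * ∑ n ∈ range N, ∏ i, (ζ i ^ t i) ^ factorialExp (p i) n := by
    intro N
    rw [Finset.card_filter]
    push_cast
    have : ∀ n ∈ range N, (if ∀ i, factorialExp (p i) n ≡ a i [MOD m i] then (1 : ℂ) else 0)
        = ∑ t ∈ Φ, c t * ∏ i, (ζ i ^ t i) ^ factorialExp (p i) n := by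
      intro n _
      have e : (if ∀ i, factorialExp (p i) n ≡ a i [MOD m i] then (1 : ℂ) else 0)
          = ∏ i, (if factorialExp (p i) n ≡ a i [MOD m i] then (1 : ℂ) else 0) := by
        rw [Finset.prod_ite_zero]; simp
      rw [e, Finset.prod_congr rfl fun i _ =>
        char_sum (m i) (factorialExp (p i) n) (a i) (hm i) (ha i) (ζ i) (hζ i),
        Finset.prod_univ_sum]
      refine Finset.sum_congr rfl fun t _ => ?_
      rw [hc, ← Finset.prod_mul_distrib]
      exact Finset.prod_congr rfl fun i _ => by ring
    rw [Finset.sum_congr rfl this, Finset.sum_comm]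
    exact Finset.sum_congr rfl fun t _ => (Finset.mul_sum _ _ _).symm
  have h0 : (fun _ => 0 : Fin k → ℕ) ∈ Φ := by
    simp only [hΦ, Fintype.mem_piFinset, Finset.mem_range]
    intro i; have := hm i; omega
  have hlim : ∀ t ∈ Φ, Filter.Tendsto
      (fun N : ℕ => c t * ((∑ n ∈ range N, ∏ i, (ζ i ^ t i) ^ factorialExp (p i) n) / (N : ℂ)))
      Filter.atTop (nhds (if t = fun _ => 0 then ∏ i, (1 / m i : ℂ) else 0)) := by
    intro t ht
    by_cases h : t = fun _ => 0
    · rw [if_pos h]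
      refine Filter.Tendsto.congr' (f₁ := fun _ => ∏ i, (1 / m i : ℂ)) ?_ tendsto_const_nhds
      filter_upwards [Filter.eventually_gt_atTop 0] with N hN
      have : (N : ℂ) ≠ 0 := by exact_mod_cast hN.ne'
      simp [h, hc, this]
    · rw [if_neg h]
      obtain ⟨i0, hi0⟩ : ∃ i, t i ≠ 0 := by
        by_contra hcon; push Not at hcon; exact h (funext hcon)
      have hlt : t i0 < m i0 := by
        have := Fintype.mem_piFinset.1 ht i0; simpa using this
      have := weyl k p m hp hpdist hm hpm (fun i => ζ i ^ t i)
        (fun i => by rw [← pow_mul, mul_comm, pow_mul, (hζ i).pow_eq_one, one_pow]) i0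
        ((hζ i0).pow_ne_one_of_pos_of_lt hi0 hlt)
      simpa using this.const_mul (c t)
  have hsum := tendsto_finsetSum Φ hlim
  rw [Finset.sum_ite_eq' Φ, if_pos h0] at hsum
  have hsum2 := hsum.const_mul (∏ i, (m i : ℂ))
  have e1 : (∏ i, (m i : ℂ)) * ∏ i, (1 / m i : ℂ) = 1 := by
    rw [← Finset.prod_mul_distrib]
    exact Finset.prod_eq_one fun i _ => by field_simp [hm0 i]
  rw [e1] at hsum2
  have hre := (Complex.continuous_re.tendsto 1).comp hsum2
  rw [Complex.one_re] at hre
  refine hre.congr fun N => ?_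
  simp only [Function.comp]
  rw [← Complex.ofReal_re ((((Finset.range N).filter
            (fun n => ∀ i, factorialExp (p i) n ≡ a i [MOD m i])).card : ℝ) /
          ((N : ℝ) / ∏ i, (m i : ℝ)))]
  congr 1
  push_cast
  rw [hcount N, ← div_mul, mul_comm]
  congr 1
  rw [Finset.sum_div]
  exact Finset.sum_congr rfl fun t _ => by rw [mul_div_assoc]
end

section
/- Let p_1, …, p_k be distinct odd primes and let ε_1, …, ε_k ∈ {0, 1}. Then #{0 ≤ n < N : e_{p_i}(n) ≡ ε_i (mod 2) for all 1 ≤ i ≤ k} is asymptotic to N/2^k as N → ∞; that is, the limit of 2^k/N times the left-hand side equals 1. -/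
namespace FE

def Small (C : ℕ → ℝ) (e : ℝ) : Prop := ∃ K : ℝ, ∀ N : ℕ, |∑ n ∈ Finset.range N, C n| ≤ e * N + K

lemma small_mono {C : ℕ → ℝ} {e e' : ℝ} (h : Small C e) (he : e ≤ e') : Small C e' := by
  obtain ⟨K, hK⟩ := h
  refine ⟨K, fun N => (hK N).trans ?_⟩
  gcongr

lemma small_add {C D : ℕ → ℝ} {e e' : ℝ} (h : Small C e) (h' : Small D e') :
    Small (fun n => C n + D n) (e + e') := by
  obtain ⟨K, hK⟩ := h
  obtain ⟨K', hK'⟩ := h'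
  refine ⟨K + K', fun N => ?_⟩
  rw [Finset.sum_add_distrib]
  have := abs_add_le (∑ n ∈ Finset.range N, C n) (∑ n ∈ Finset.range N, D n)
  linarith [hK N, hK' N]

lemma small_zero : Small (fun _ => 0) 0 := ⟨0, fun N => by simp⟩

lemma small_sum {ι : Type*} (s : Finset ι) {C : ι → ℕ → ℝ} {e : ι → ℝ}
    (h : ∀ i ∈ s, Small (C i) (e i)) : Small (fun n => ∑ i ∈ s, C i n) (∑ i ∈ s, e i) := by
  classical
  induction s using Finset.induction_on with
  | empty => simpa using small_zero
  | insert a s ha ih =>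
    simp only [Finset.sum_insert ha]
    exact small_add (h a (Finset.mem_insert_self _ _))
      (ih fun i hi => h i (Finset.mem_insert_of_mem hi))

lemma small_mul {C : ℕ → ℝ} {e : ℝ} (c : ℝ) (h : Small C e) :
    Small (fun n => c * C n) (|c| * e) := by
  obtain ⟨K, hK⟩ := h
  refine ⟨|c| * K, fun N => ?_⟩
  rw [← Finset.mul_sum, abs_mul]
  have := mul_le_mul_of_nonneg_left (hK N) (abs_nonneg c)
  linarith

lemma small_of_abs_le {C E : ℕ → ℝ} {e : ℝ} (h : ∀ n, |C n| ≤ E n) (h' : Small E e) :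
    Small C e := by
  obtain ⟨K, hK⟩ := h'
  refine ⟨K, fun N => ?_⟩
  calc |∑ n ∈ Finset.range N, C n| ≤ ∑ n ∈ Finset.range N, |C n| := Finset.abs_sum_le_sum_abs _ _
    _ ≤ ∑ n ∈ Finset.range N, E n := Finset.sum_le_sum fun n _ => h n
    _ ≤ _ := (le_abs_self _).trans (hK N)

lemma small_const (c : ℝ) : Small (fun _ => c) |c| :=
  ⟨0, fun N => by simp [abs_mul, mul_comm]⟩

lemma small_shift {C : ℕ → ℝ} {e : ℝ} (h : Small C e) (a : ℕ) :
    Small (fun n => C (n + a)) e := by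
  obtain ⟨K, hK⟩ := h
  refine ⟨e * a + K + |∑ n ∈ Finset.range a, C n|, fun N => ?_⟩
  have h1 : ∑ n ∈ Finset.range N, C (n + a)
      = ∑ n ∈ Finset.range (a + N), C n - ∑ n ∈ Finset.range a, C n := by
    rw [Finset.sum_range_add]; simp [add_comm]
  rw [h1]
  have := abs_sub (∑ n ∈ Finset.range (a + N), C n) (∑ n ∈ Finset.range a, C n)
  have h2 := hK (a + N)
  push_cast at h2
  linarith

lemma small_shift_sub {F : ℕ → ℝ} (hF : ∀ n, |F n| ≤ 1) (a : ℕ) :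
    Small (fun n => F n - F (n + a)) 0 := by
  induction a with
  | zero => simpa using small_zero
  | succ a ih =>
    have h1 : Small (fun n => F (n + a) - F (n + (a + 1))) 0 := by
      refine ⟨2, fun N => ?_⟩
      have := Finset.sum_range_sub' (fun n => F (n + a)) N
      have h2 : ∑ n ∈ Finset.range N, (F (n + a) - F (n + (a + 1))) = F a - F (N + a) := by
        rw [zero_add] at this
        rw [← this]
        exact Finset.sum_congr rfl fun n _ => by rw [add_right_comm n 1 a, add_assoc]
      rw [h2]
      have := abs_sub (F a) (F (N + a))
      linarith [hF a, hF (N + a)]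
    have := small_add ih h1
    simpa using this

lemma sum_range_mul' (C : ℕ → ℝ) (q a : ℕ) :
    ∑ n ∈ Finset.range (a * q), C n = ∑ n ∈ Finset.range a, ∑ d ∈ Finset.range q, C (q * n + d) := by
  induction a with
  | zero => simp
  | succ a ih => rw [Nat.succ_mul, Finset.sum_range_add, ih, Finset.sum_range_succ, mul_comm a q]

lemma small_periodic {C : ℕ → ℝ} {T : ℕ} (hT : 0 < T) (hC : ∀ n, |C n| ≤ 1)
    (hper : ∀ n, C (n % T) = C n) : Small C (|∑ n ∈ Finset.range T, C n| / T) := by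
  refine ⟨T, fun N => ?_⟩
  set A := ∑ n ∈ Finset.range T, C n with hA
  have h1 : ∑ n ∈ Finset.range N, C n = (N / T : ℕ) * A + ∑ d ∈ Finset.range (N % T), C d := by
    conv_lhs => rw [← Nat.div_add_mod' N T, Finset.sum_range_add, sum_range_mul']
    congr 1
    · have : ∀ n ∈ Finset.range (N / T), ∑ d ∈ Finset.range T, C (T * n + d) = A := by
        intro n _
        refine Finset.sum_congr rfl fun d hd => ?_
        rw [← hper, Nat.mul_add_mod, hper]
      rw [Finset.sum_congr rfl this]; simp
    · refine Finset.sum_congr rfl fun d hd => ?_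
      rw [← hper, Nat.mul_add_mod', hper]
  have h2 : |∑ d ∈ Finset.range (N % T), C d| ≤ T := by
    calc |∑ d ∈ Finset.range (N % T), C d| ≤ ∑ d ∈ Finset.range (N % T), |C d| :=
          Finset.abs_sum_le_sum_abs _ _
      _ ≤ ∑ d ∈ Finset.range (N % T), 1 := Finset.sum_le_sum fun n _ => hC n
      _ = (N % T : ℕ) := by simp
      _ ≤ T := by exact_mod_cast (Nat.mod_lt N hT).le
  rw [h1]
  have h3 : |((N / T : ℕ) : ℝ) * A| ≤ |A| / T * N := by
    rw [abs_mul, Nat.abs_cast]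
    have : ((N / T : ℕ) : ℝ) ≤ N / T := Nat.cast_div_le
    calc ((N / T : ℕ) : ℝ) * |A| ≤ N / T * |A| := by gcongr
      _ = _ := by ring
  exact (abs_add_le _ _).trans (add_le_add h3 h2)

lemma vdc {F : ℕ → ℝ} (hF : ∀ n, |F n| ≤ 1) {η : ℝ} (hη : 0 < η) (M : ℕ) (hM : 0 < M)
    (hM' : 1 / (M : ℝ) ≤ η ^ 2) (a : ℕ → ℕ)
    (h : ∀ i j, i ≠ j → Small (fun n => F (n + a i) * F (n + a j)) (η ^ 2)) :
    Small F (2 * η) := by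
  have hMr : (0 : ℝ) < M := by exact_mod_cast hM
  set G : ℕ → ℝ := fun n => ∑ i ∈ Finset.range M, F (n + a i) with hG
  have h1 : Small (fun n => G n ^ 2) (M + M ^ 2 * η ^ 2) := by
    have hh : ∀ i ∈ Finset.range M, ∀ j ∈ Finset.range M,
        Small (fun n => F (n + a i) * F (n + a j)) ((if i = j then 1 else 0) + η ^ 2) := by
      intro i _ j _
      by_cases hij : i = j
      · subst hij
        refine small_mono (e := |1|) (small_of_abs_le (E := fun _ => 1) ?_ (small_const 1)) ?_
        · intro n
          rw [abs_mul]
          exact mul_le_one₀ (hF _) (abs_nonneg _) (hF _)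
        · simp; positivity
      · simpa [hij] using h i j hij
    have := small_sum (Finset.range M) (fun i hi => small_sum (Finset.range M) (hh i hi))
    have e1 : (∑ i ∈ Finset.range M, ∑ j ∈ Finset.range M, ((if i = j then 1 else 0) + η ^ 2))
        = M + M ^ 2 * η ^ 2 := by
      simp only [Finset.sum_add_distrib, Finset.sum_ite_eq, Finset.sum_const, Finset.card_range]
      rw [Finset.sum_congr rfl (g := fun _ => (1 : ℝ)) (by intro x hx; simp [Finset.mem_range.1 hx])]
      simp; ring
    rw [e1] at this
    have e2 : (fun n => G n ^ 2) = fun n => ∑ i ∈ Finset.range M, ∑ j ∈ Finset.range M,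
        F (n + a i) * F (n + a j) := by
      funext n
      rw [hG, sq, Finset.sum_mul_sum]
    rw [e2]; exact this
  have h2 : Small G (η * M / 2 + (M + M ^ 2 * η ^ 2) / (2 * (η * M))) := by
    have hl : 0 < η * M := by positivity
    have := small_add (small_const (η * M / 2)) (small_mul (1 / (2 * (η * M))) h1)
    refine small_mono (small_of_abs_le ?_ this) ?_
    · intro n
      have : η * M / 2 + 1 / (2 * (η * M)) * G n ^ 2 = ((η * M) ^ 2 + |G n| ^ 2) / (2 * (η * M)) := by
        rw [sq_abs]; field_simp
      simp only [this]
      rw [le_div_iff₀ (by positivity)]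
      nlinarith [sq_nonneg (η * M - |G n|)]
    · rw [abs_of_pos (by positivity), abs_of_pos (by positivity)]
      apply le_of_eq; ring
  have h3 : Small (fun n => ∑ i ∈ Finset.range M, (F n - F (n + a i))) (∑ i ∈ Finset.range M, 0) :=
    small_sum _ fun i _ => small_shift_sub hF (a i)
  have h4 := small_mul (1 / (M : ℝ)) (small_add h3 h2)
  have e3 : (fun n => 1 / (M : ℝ) * (∑ i ∈ Finset.range M, (F n - F (n + a i)) + G n)) = F := by
    funext n
    rw [hG, ← Finset.sum_add_distrib]
    simp; field_simp
  rw [e3] at h4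
  refine small_mono h4 ?_
  rw [abs_of_pos (by positivity)]
  have : 1 / (M : ℝ) * (∑ i ∈ Finset.range M, 0 + (η * M / 2 + (M + M ^ 2 * η ^ 2) / (2 * (η * M))))
     = η + (1 / (M : ℝ)) / (2 * η) := by
    simp; field_simp; ring
  rw [this]
  have : 1 / (M : ℝ) / (2 * η) ≤ η := by
    rw [div_le_iff₀ (by positivity)]; nlinarith
  linarith

lemma sum_crt {P W : ℕ → ℝ} {Q R : ℕ} (hQ : 0 < Q) (hR : 0 < R) (co : Q.Coprime R)
    (hP : ∀ n, P (n % Q) = P n) (hW : ∀ n, W (n % R) = W n) :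
    ∑ n ∈ Finset.range (Q * R), P n * W n
      = (∑ n ∈ Finset.range Q, P n) * ∑ n ∈ Finset.range R, W n := by
  rw [Finset.sum_mul_sum, ← Finset.sum_product']
  refine Finset.sum_bij (fun n _ => (n % Q, n % R)) ?_ ?_ ?_ ?_
  · intro n _
    simp [Nat.mod_lt, hQ, hR]
  · intro a ha b hb hab
    simp only [Prod.mk.injEq] at hab
    have h : a ≡ b [MOD Q * R] := (Nat.modEq_and_modEq_iff_modEq_mul co).1 hab
    exact Nat.ModEq.eq_of_lt_of_lt h (Finset.mem_range.1 ha) (Finset.mem_range.1 hb)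
  · rintro ⟨x, y⟩ hxy
    simp only [Finset.mem_product, Finset.mem_range] at hxy
    refine ⟨Nat.chineseRemainder co x y, ?_, ?_⟩
    · exact Finset.mem_range.2 (Nat.chineseRemainder_lt_mul co x y hQ.ne' hR.ne')
    · have h := (Nat.chineseRemainder co x y).2
      have h1 : _ % Q = x % Q := h.1
      have h2 : _ % R = y % R := h.2
      rw [Nat.mod_eq_of_lt hxy.1] at h1
      rw [Nat.mod_eq_of_lt hxy.2] at h2
      simp [h1, h2]
  · intro n _
    simp [hP, hW]

noncomputable def f (p n : ℕ) : ℝ := (-1) ^ factorialExp p n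

lemma f_sq (p n : ℕ) : f p n * f p n = 1 := by
  unfold f; rw [← mul_pow]; simp

lemma f_abs (p n : ℕ) : |f p n| = 1 := by
  unfold f; simp

lemma fe_step {p : ℕ} (hp : p.Prime) (n d : ℕ) (hd : d < p) :
    factorialExp p (p * n + d) = factorialExp p n + n := by
  have := Fact.mk hp
  unfold factorialExp
  rw [Nat.factorization_def _ hp, Nat.factorization_def _ hp, padicValNat_factorial_mul_add _ hd,
    padicValNat_factorial_mul]

lemma fe_zero (p : ℕ) : factorialExp p 0 = 0 := by simp [factorialExp]

lemma f_small {p : ℕ} (hp : p.Prime) {r : ℕ} (hr : r < p ^ 2) : f p r = (-1) ^ (r / p) := by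
  have h1 : r / p < p := by rw [Nat.div_lt_iff_lt_mul hp.pos]; nlinarith
  unfold f
  have h := fe_step hp (r / p) (r % p) (Nat.mod_lt _ hp.pos)
  have h2 := fe_step hp 0 (r / p) h1
  rw [Nat.div_add_mod] at h
  simp only [mul_zero, zero_add, fe_zero] at h2
  rw [h, h2, zero_add]

lemma f_mul {p : ℕ} (hp : p.Prime) (ho : Odd p) (n : ℕ) {r : ℕ} (hr : r < p ^ 2) :
    f p (p ^ 2 * n + r) = f p r * f p n := by
  rw [f_small hp hr]
  have h1 : r / p < p := by rw [Nat.div_lt_iff_lt_mul hp.pos]; nlinarith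
  have h := fe_step hp (p * n + r / p) (r % p) (Nat.mod_lt _ hp.pos)
  rw [fe_step hp _ _ h1] at h
  have e : p * (p * n + r / p) + r % p = p ^ 2 * n + r := by
    conv_rhs => rw [← Nat.div_add_mod r p]
    ring
  rw [e] at h
  unfold f
  rw [h, pow_add, pow_add, pow_add, pow_mul, ho.neg_one_pow]
  have : (-1 : ℝ) ^ n * (-1) ^ n = 1 := by rw [← mul_pow]; simp
  linear_combination ((-1 : ℝ) ^ factorialExp p n * (-1 : ℝ) ^ (r / p)) * this

lemma f_mul_pow {p : ℕ} (hp : p.Prime) (ho : Odd p) (m : ℕ) : ∀ (n r : ℕ), r < (p ^ 2) ^ m →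
    f p ((p ^ 2) ^ m * n + r) = f p r * f p n := by
  have hq : 0 < p ^ 2 := by have := hp.pos; positivity
  induction m with
  | zero =>
    intro n r hr
    have : r = 0 := by simpa using hr
    subst this
    simp [f, fe_zero]
  | succ m ih =>
    intro n r hr
    have hd : r / p ^ 2 < (p ^ 2) ^ m := by
      rw [Nat.div_lt_iff_lt_mul hq, ← pow_succ]; exact hr
    have e : (p ^ 2) ^ (m + 1) * n + r = p ^ 2 * ((p ^ 2) ^ m * n + r / p ^ 2) + r % p ^ 2 := by
      conv_lhs => rw [← Nat.div_add_mod r (p ^ 2)]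
      ring
    rw [e, f_mul hp ho _ (Nat.mod_lt _ hq), ih _ _ hd]
    conv_rhs => rw [← Nat.div_add_mod r (p ^ 2), f_mul hp ho _ (Nat.mod_lt _ hq)]
    ring

lemma f_corr {p : ℕ} (hp : p.Prime) (ho : Odd p) (m n h : ℕ)
    (hn : n % (p ^ 2) ^ m + h < (p ^ 2) ^ m) :
    f p n * f p (n + h) = f p (n % (p ^ 2) ^ m) * f p ((n + h) % (p ^ 2) ^ m) := by
  set Q := (p ^ 2) ^ m with hQ
  have h1 : f p n = f p (n % Q) * f p (n / Q) := by
    conv_lhs => rw [← Nat.div_add_mod n Q]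
    exact f_mul_pow hp ho m _ _ (lt_of_le_of_lt (Nat.le_add_right _ _) hn)
  have h2 : f p (n + h) = f p (n % Q + h) * f p (n / Q) := by
    conv_lhs => rw [← Nat.div_add_mod n Q, add_assoc]
    exact f_mul_pow hp ho m _ _ hn
  have h3 : (n + h) % Q = n % Q + h := by
    rw [← Nat.mod_add_mod, Nat.mod_eq_of_lt hn]
  rw [h1, h2, h3]
  linear_combination (f p (n % Q) * f p (n % Q + h)) * f_sq p (n / Q)

noncomputable def Gam (p m h : ℕ) : ℝ :=
  ∑ n ∈ Finset.range ((p ^ 2) ^ m), f p n * f p ((n + h) % (p ^ 2) ^ m)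

lemma Gam_le (p m h : ℕ) : |Gam p m h| ≤ ((p : ℝ) ^ 2) ^ m := by
  unfold Gam
  refine (Finset.abs_sum_le_sum_abs _ _).trans ?_
  simp [abs_mul, f_abs]

lemma Gam_succ {p : ℕ} (hp : p.Prime) (ho : Odd p) (m t r : ℕ) :
    Gam p (m + 1) (p ^ 2 * t + r)
      = ∑ d ∈ Finset.range (p ^ 2), f p d * f p ((d + r) % p ^ 2) * Gam p m (t + (d + r) / p ^ 2) := by
  have hq : 0 < p ^ 2 := by have := hp.pos; positivity
  unfold Gam
  rw [pow_succ (p ^ 2) m, sum_range_mul', Finset.sum_comm]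
  refine Finset.sum_congr rfl fun d hd => ?_
  rw [Finset.mul_sum]
  refine Finset.sum_congr rfl fun n _ => ?_
  have hd' := Finset.mem_range.1 hd
  have e : (p ^ 2 * n + d + (p ^ 2 * t + r)) % ((p ^ 2) ^ m * p ^ 2)
      = p ^ 2 * ((n + (t + (d + r) / p ^ 2)) % (p ^ 2) ^ m) + (d + r) % p ^ 2 := by
    have : p ^ 2 * n + d + (p ^ 2 * t + r) = (d + r) + p ^ 2 * (n + t) := by ring
    rw [mul_comm ((p ^ 2) ^ m), Nat.mod_mul, this, Nat.add_mul_mod_self_left,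
      Nat.add_mul_div_left _ _ hq]
    rw [add_comm]
    congr 3
    ring
  rw [e, f_mul hp ho _ hd', f_mul hp ho _ (Nat.mod_lt _ hq)]
  ring

lemma Gam_mul {p : ℕ} (hp : p.Prime) (ho : Odd p) (m t : ℕ) :
    Gam p (m + 1) (p ^ 2 * t) = (p : ℝ) ^ 2 * Gam p m t := by
  have := Gam_succ hp ho m t 0
  rw [add_zero] at this
  rw [this, Finset.sum_congr rfl (g := fun _ => Gam p m t)]
  · simp
  · intro d hd
    have hd' := Finset.mem_range.1 hd
    simp [Nat.mod_eq_of_lt hd', Nat.div_eq_of_lt hd', f_sq]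

lemma Gam_mul_pow {p : ℕ} (hp : p.Prime) (ho : Odd p) (m t a : ℕ) :
    Gam p (m + a) ((p ^ 2) ^ a * t) = ((p : ℝ) ^ 2) ^ a * Gam p m t := by
  induction a with
  | zero => simp
  | succ a ih =>
    rw [pow_succ', mul_assoc, ← add_assoc, Gam_mul hp ho, ih]; ring

lemma Gam_contract {p : ℕ} (hp : p.Prime) (ho : Odd p) (m t r : ℕ) (hr : r = 1 ∨ r = 2) (B : ℝ)
    (h0 : |Gam p m t| ≤ B) (h1 : |Gam p m (t + 1)| ≤ B) :
    |Gam p (m + 1) (p ^ 2 * t + r)| ≤ ((p : ℝ) ^ 2 - 2) * B := by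
  have hp3 : 3 ≤ p := by
    have := hp.two_le
    rcases ho with ⟨k, hk⟩
    omega
  have hpq : 3 * p ≤ p ^ 2 := by nlinarith
  rw [Gam_succ hp ho]
  set T : ℕ → ℝ := fun d => f p d * f p ((d + r) % p ^ 2) * Gam p m (t + (d + r) / p ^ 2) with hT
  have hTb : ∀ d ∈ Finset.range (p ^ 2), |T d| ≤ B := by
    intro d hd
    have hd' := Finset.mem_range.1 hd
    rw [hT]
    simp only [abs_mul, f_abs, one_mul]
    have : (d + r) / p ^ 2 < 2 := by
      rw [Nat.div_lt_iff_lt_mul (by omega)]; omega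
    interval_cases (d + r) / p ^ 2
    · simpa using h0
    · exact h1
  have hT0 : T 0 = Gam p m t := by
    have h : r < p ^ 2 := by omega
    have h' : r < p := by omega
    simp only [hT, zero_add, Nat.mod_eq_of_lt h, Nat.div_eq_of_lt h]
    rw [f_small hp h, f_small hp (by omega), Nat.div_eq_of_lt h']
    simp
  have hT1 : T (p - 1) = - Gam p m t := by
    have h : p - 1 + r < p ^ 2 := by omega
    have e : (p - 1 + r) / p = 1 := by
      apply Nat.div_eq_of_lt_le <;> omega
    simp only [hT, Nat.mod_eq_of_lt h, Nat.div_eq_of_lt h]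
    rw [f_small hp h, f_small hp (by omega), Nat.div_eq_of_lt (by omega : p - 1 < p), e]
    simp
  have hm0 : 0 ∈ Finset.range (p ^ 2) := by simp; omega
  have hm1 : p - 1 ∈ (Finset.range (p ^ 2)).erase 0 := by
    simp; omega
  change |∑ d ∈ Finset.range (p ^ 2), T d| ≤ _
  rw [← Finset.add_sum_erase _ _ hm0, ← Finset.add_sum_erase _ _ hm1, hT0, hT1]
  rw [← add_assoc, add_neg_cancel, zero_add]
  calc _ ≤ ∑ d ∈ ((Finset.range (p ^ 2)).erase 0).erase (p - 1), |T d| :=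
        Finset.abs_sum_le_sum_abs _ _
    _ ≤ ∑ d ∈ ((Finset.range (p ^ 2)).erase 0).erase (p - 1), B :=
        Finset.sum_le_sum fun d hd => hTb d (Finset.mem_of_mem_erase (Finset.mem_of_mem_erase hd))
    _ = _ := by
      rw [Finset.sum_const, Finset.card_erase_of_mem hm1, Finset.card_erase_of_mem hm0,
        Finset.card_range, nsmul_eq_mul, Nat.sub_sub, Nat.cast_sub (by omega)]
      push_cast; ring

def rep (q : ℕ) : ℕ → ℕ
  | 0 => 0
  | L + 1 => q * rep q L + 1

lemma rep_add (q a L : ℕ) : rep q (a + L) = rep q a + q ^ a * rep q L := by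
  induction a with
  | zero => simp [rep]
  | succ a ih =>
    rw [Nat.succ_add, rep, rep, ih]; ring

lemma Gam_rep {p : ℕ} (hp : p.Prime) (ho : Odd p) (L j : ℕ) :
    |Gam p (j + L) (rep (p ^ 2) L)| ≤ ((p : ℝ) ^ 2 - 2) ^ L * ((p : ℝ) ^ 2) ^ j ∧
    |Gam p (j + L) (rep (p ^ 2) L + 1)| ≤ ((p : ℝ) ^ 2 - 2) ^ L * ((p : ℝ) ^ 2) ^ j := by
  induction L with
  | zero =>
    simp only [add_zero, pow_zero, one_mul]
    exact ⟨Gam_le _ _ _, Gam_le _ _ _⟩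
  | succ L ih =>
    have h1 := Gam_contract hp ho (j + L) (rep (p ^ 2) L) 1 (Or.inl rfl) _ ih.1 ih.2
    have h2 := Gam_contract hp ho (j + L) (rep (p ^ 2) L) 2 (Or.inr rfl) _ ih.1 ih.2
    rw [pow_succ' _ L, mul_assoc]
    exact ⟨h1, h2⟩

lemma Gam_final {p : ℕ} (hp : p.Prime) (ho : Odd p) (a L j : ℕ) :
    |Gam p (j + L + a) ((p ^ 2) ^ a * rep (p ^ 2) L)| / ((p : ℝ) ^ 2) ^ (j + L + a)
      ≤ (1 - 2 / (p : ℝ) ^ 2) ^ L := by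
  have hpp : (0 : ℝ) < (p : ℝ) ^ 2 := by have := hp.pos; positivity
  rw [Gam_mul_pow hp ho, abs_mul, abs_of_pos (by positivity), div_le_iff₀ (by positivity)]
  have e : (1 - 2 / (p : ℝ) ^ 2) = ((p : ℝ) ^ 2 - 2) / (p : ℝ) ^ 2 := by
    rw [sub_div, div_self hpp.ne']
  rw [e, div_pow, pow_add, pow_add]
  have := mul_le_mul_of_nonneg_left (Gam_rep hp ho L j).1 (by positivity : 0 ≤ ((p : ℝ) ^ 2) ^ a)
  refine this.trans (le_of_eq ?_)
  field_simp

noncomputable def Ex (Q h n : ℕ) : ℝ := if Q ≤ n % Q + h then 1 else 0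

lemma small_Ex {Q : ℕ} (hQ : 0 < Q) (h : ℕ) : Small (Ex Q h) (h / Q) := by
  have h1 : Small (Ex Q h) (|∑ n ∈ Finset.range Q, Ex Q h n| / Q) := by
    refine small_periodic hQ ?_ ?_
    · intro n; unfold Ex; split_ifs <;> simp
    · intro n; simp [Ex]
  refine small_mono h1 ?_
  gcongr
  have h2 : ∑ n ∈ Finset.range Q, Ex Q h n = (((Finset.range Q).filter (fun n => Q ≤ n % Q + h)).card : ℝ) := by
    simp [Ex, Finset.sum_ite]
  rw [h2, Nat.abs_cast]
  have h3 : (Finset.range Q).filter (fun n => Q ≤ n % Q + h) ⊆ Finset.Ico (Q - h) Q := by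
    intro n hn
    simp only [Finset.mem_filter, Finset.mem_range] at hn
    rw [Nat.mod_eq_of_lt hn.1] at hn
    simp; omega
  have h4 := Finset.card_le_card h3
  rw [Nat.card_Ico] at h4
  exact_mod_cast h4.trans (by omega)

lemma abs_prod_one {ι : Type*} (s : Finset ι) (g : ι → ℝ) (h : ∀ i ∈ s, |g i| = 1) :
    |∏ i ∈ s, g i| = 1 := by
  rw [Finset.abs_prod, Finset.prod_eq_one h]

lemma corr {ι : Type*} [DecidableEq ι] (s : Finset ι) (p : ι → ℕ)
    (hp : ∀ i, (p i).Prime) (ho : ∀ i, Odd (p i)) (inj : Function.Injective p)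
    (i₀ : ι) (hi₀ : i₀ ∈ s) (a L : ℕ) {δ : ℝ} (hδ : 0 < δ)
    (hL : (1 - 2 / (p i₀ : ℝ) ^ 2) ^ L ≤ δ / 2) :
    Small (fun n => (∏ i ∈ s, f (p i) n) *
      ∏ i ∈ s, f (p i) (n + (p i₀ ^ 2) ^ a * rep (p i₀ ^ 2) L)) δ := by
  set h := (p i₀ ^ 2) ^ a * rep (p i₀ ^ 2) L with hh
  obtain ⟨j, hj⟩ : ∃ j : ℕ, 2 * s.card * h / (δ / 2) < (j : ℝ) := exists_nat_gt _
  set m := j + L + a with hm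
  set Q : ι → ℕ := fun i => (p i ^ 2) ^ m with hQ
  have hQpos : ∀ i, 0 < Q i := fun i => by have := (hp i).pos; positivity
  set g : ι → ℕ → ℝ := fun i n => f (p i) (n % Q i) * f (p i) ((n + h) % Q i) with hg
  have hgabs : ∀ i n, |g i n| = 1 := fun i n => by simp [hg, abs_mul, f_abs]
  set R := ∏ i ∈ s.erase i₀, Q i with hR
  have hRpos : 0 < R := Finset.prod_pos fun i _ => hQpos i
  set W : ℕ → ℝ := fun n => ∏ i ∈ s.erase i₀, g i n with hW
  have hWabs : ∀ n, |W n| = 1 := fun n => abs_prod_one _ _ fun i _ => hgabs i n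
  have hgper : ∀ i n T, Q i ∣ T → g i (n % T) = g i n := by
    intro i n T hT
    have e1 : n % T % Q i = n % Q i := Nat.mod_mod_of_dvd _ hT
    have e2 : (n % T + h) % Q i = (n + h) % Q i := by
      rw [Nat.add_mod, e1, ← Nat.add_mod]
    simp only [hg, e1, e2]
  have hWper : ∀ n T, R ∣ T → W (n % T) = W n := by
    intro n T hT
    refine Finset.prod_congr rfl fun i hi => hgper i n T ?_
    exact (Finset.dvd_prod_of_mem Q hi).trans hT
  have hco : (Q i₀).Coprime R := by
    refine Nat.Coprime.prod_right fun i hi => ?_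
    refine Nat.Coprime.pow _ _ (Nat.Coprime.pow _ _ ?_)
    rw [Nat.coprime_primes (hp _) (hp _)]
    exact fun hc => (Finset.ne_of_mem_erase hi) (inj hc).symm
  have hsum := sum_crt (P := g i₀) (W := W) (hQpos i₀) hRpos hco
    (fun n => hgper i₀ n _ dvd_rfl) (fun n => hWper n _ dvd_rfl)
  have hG : ∑ n ∈ Finset.range (Q i₀), g i₀ n = Gam (p i₀) m h := by
    unfold Gam
    refine Finset.sum_congr rfl fun n hn => ?_
    simp only [hg]
    rw [Nat.mod_eq_of_lt (Finset.mem_range.1 hn)]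
  have hper : Small (fun n => g i₀ n * W n) (δ / 2) := by
    have h1 := small_periodic (C := fun n => g i₀ n * W n) (T := Q i₀ * R)
      (Nat.mul_pos (hQpos _) hRpos) (fun n => by rw [abs_mul, hgabs, hWabs]; simp)
      (fun n => by
        simp only [hgper i₀ n _ (Dvd.intro _ rfl), hWper n _ (Dvd.intro_left _ rfl)])
    refine small_mono h1 ?_
    simp only [hsum, hG]
    have h2 := Gam_final (hp i₀) (ho i₀) a L j
    refine le_trans ?_ (h2.trans hL)
    have h3 : |∑ n ∈ Finset.range R, W n| ≤ R := by
      refine (Finset.abs_sum_le_sum_abs _ _).trans ?_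
      simp [hWabs]
    have hQr : (0 : ℝ) < Q i₀ := by exact_mod_cast hQpos i₀
    have hRr : (0 : ℝ) < R := by exact_mod_cast hRpos
    rw [abs_mul, Nat.cast_mul, mul_div_mul_comm]
    have h4 : |∑ n ∈ Finset.range R, W n| / R ≤ 1 := by rw [div_le_one hRr]; exact h3
    have h5 : (Q i₀ : ℝ) = ((p i₀ : ℝ) ^ 2) ^ (j + L + a) := by simp [hQ, hm]
    rw [← h5]
    exact mul_le_of_le_one_right (by positivity) h4
  have hEx : Small (fun n => ∑ i ∈ s, 2 * Ex (Q i) h n) (∑ i ∈ s, |2| * ((h : ℝ) / Q i)) :=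
    small_sum s fun i _ => small_mul 2 (small_Ex (hQpos i) h)
  have hExb : ∑ i ∈ s, |2| * ((h : ℝ) / Q i) ≤ δ / 2 := by
    have hj0 : (0 : ℝ) < j := lt_of_le_of_lt (by positivity) hj
    have : ∀ i ∈ s, |2| * ((h : ℝ) / Q i) ≤ 2 * (h / j) := by
      intro i _
      rw [abs_of_pos (by norm_num)]
      have : (j : ℝ) ≤ Q i := by
        have h1 : j < 2 ^ j := Nat.lt_two_pow_self
        have h2 : 2 ^ j ≤ 2 ^ m := Nat.pow_le_pow_right (by norm_num) (by omega)
        have h3 : 2 ^ m ≤ Q i := Nat.pow_le_pow_left (by nlinarith [(hp i).two_le]) _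
        exact_mod_cast (h1.le.trans h2).trans h3
      gcongr
    refine (Finset.sum_le_sum this).trans ?_
    rw [Finset.sum_const, nsmul_eq_mul]
    rw [div_lt_iff₀ (by positivity)] at hj
    have : (s.card : ℝ) * (2 * (h / j)) = (2 * s.card * h) / j := by ring
    rw [this, div_le_iff₀ hj0]
    linarith
  have hdiff : Small (fun n => (∏ i ∈ s, f (p i) n) * (∏ i ∈ s, f (p i) (n + h)) - g i₀ n * W n)
      (δ / 2) := by
    refine small_of_abs_le ?_ (small_mono hEx hExb)
    intro n
    have hEn : ∀ i, 0 ≤ 2 * Ex (Q i) h n := fun i => by unfold Ex; split_ifs <;> simp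
    have e1 : g i₀ n * W n = ∏ i ∈ s, g i n := Finset.mul_prod_erase s (fun i => g i n) hi₀
    rw [e1, ← Finset.prod_mul_distrib]
    by_cases hc : ∀ i ∈ s, n % Q i + h < Q i
    · have e2 : ∏ i ∈ s, f (p i) n * f (p i) (n + h) = ∏ i ∈ s, g i n :=
        Finset.prod_congr rfl fun i hi => f_corr (hp i) (ho i) m n h (hc i hi)
      rw [e2, sub_self, abs_zero]
      exact Finset.sum_nonneg fun i _ => hEn i
    · push Not at hc
      obtain ⟨i, hi, hc⟩ := hc
      have h1 := Finset.single_le_sum (fun i _ => hEn i) hi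
      have h2 : Ex (Q i) h n = 1 := by unfold Ex; rw [if_pos hc]
      rw [h2] at h1
      have h3 := abs_sub (∏ i ∈ s, f (p i) n * f (p i) (n + h)) (∏ i ∈ s, g i n)
      rw [abs_prod_one s _ (fun i _ => hgabs i n),
        abs_prod_one s _ (fun i _ => by simp [abs_mul, f_abs])] at h3
      linarith
  have := small_add hdiff hper
  simpa using this

lemma small_prod {ι : Type*} [DecidableEq ι] (s : Finset ι) (p : ι → ℕ)
    (hp : ∀ i, (p i).Prime) (ho : ∀ i, Odd (p i)) (inj : Function.Injective p)
    (hs : s.Nonempty) {δ : ℝ} (hδ : 0 < δ) :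
    Small (fun n => ∏ i ∈ s, f (p i) n) δ := by
  obtain ⟨i₀, hi₀⟩ := hs
  set η := δ / 2 with hη
  have hη0 : 0 < η := by positivity
  obtain ⟨M, hM⟩ : ∃ M : ℕ, 1 / η ^ 2 < (M : ℝ) := exists_nat_gt _
  have hM0 : (0 : ℝ) < M := lt_of_le_of_lt (by positivity) hM
  have hp2 : (2 : ℝ) ≤ p i₀ := by exact_mod_cast (hp i₀).two_le
  have hc0 : 0 ≤ 1 - 2 / (p i₀ : ℝ) ^ 2 := by
    rw [sub_nonneg, div_le_one (by positivity)]; nlinarith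
  have hc1 : 1 - 2 / (p i₀ : ℝ) ^ 2 < 1 := by
    have : 0 < 2 / (p i₀ : ℝ) ^ 2 := by positivity
    linarith
  obtain ⟨L, hL⟩ := exists_pow_lt_of_lt_one (by positivity : 0 < η ^ 2 / 2) hc1
  have key : ∀ i j, i < j → Small (fun n =>
      (∏ t ∈ s, f (p t) (n + rep (p i₀ ^ 2) (L * i))) *
      ∏ t ∈ s, f (p t) (n + rep (p i₀ ^ 2) (L * j))) (η ^ 2) := by
    intro i j hij
    obtain ⟨d, rfl⟩ := Nat.exists_eq_add_of_lt hij
    have h1 := corr s p hp ho inj i₀ hi₀ (L * i) (L * (d + 1)) (δ := η ^ 2) (by positivity) (by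
      refine le_trans ?_ hL.le
      exact pow_le_pow_of_le_one hc0 hc1.le (Nat.le_mul_of_pos_right _ (Nat.succ_pos _)))
    have h2 := small_shift h1 (rep (p i₀ ^ 2) (L * i))
    have e : rep (p i₀ ^ 2) (L * (i + d + 1))
        = rep (p i₀ ^ 2) (L * i) + (p i₀ ^ 2) ^ (L * i) * rep (p i₀ ^ 2) (L * (d + 1)) := by
      rw [← rep_add]; congr 1; ring
    rw [e]
    simpa only [add_assoc] using h2
  have := vdc (F := fun n => ∏ i ∈ s, f (p i) n)
    (fun n => (abs_prod_one s _ fun i _ => f_abs _ _).le) hη0 M (by exact_mod_cast hM0)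
    (by rw [one_div_le hM0 (by positivity)]; exact hM.le)
    (fun i => rep (p i₀ ^ 2) (L * i)) (by
      intro i j hij
      rcases lt_or_gt_of_ne hij with h | h
      · exact key i j h
      · have := key j i h
        simpa only [mul_comm] using this)
  refine small_mono this ?_
  rw [hη]; linarith

lemma ind_eq {p n e : ℕ} : (1 + (-1) ^ e * f p n : ℝ) = if factorialExp p n ≡ e [MOD 2] then 2 else 0 := by
  unfold f
  rw [← pow_add]
  by_cases h : factorialExp p n ≡ e [MOD 2]
  · rw [if_pos h]
    unfold Nat.ModEq at h
    rw [Even.neg_one_pow (by rw [Nat.even_iff]; omega)]; norm_num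
  · rw [if_neg h]
    unfold Nat.ModEq at h
    rw [Odd.neg_one_pow (by rw [Nat.odd_iff]; omega)]; norm_num

lemma tendsto_of_small {C : ℕ → ℝ} (h : ∀ δ > 0, Small C δ) :
    Filter.Tendsto (fun N : ℕ => (∑ n ∈ Finset.range N, C n) / N) Filter.atTop (nhds 0) := by
  rw [Metric.tendsto_atTop]
  intro e he
  obtain ⟨K, hK⟩ := h (e / 2) (by positivity)
  obtain ⟨N₀, hN₀⟩ := exists_nat_gt (|K| / (e / 2))
  refine ⟨N₀, fun N hN => ?_⟩
  have hNN : (N₀ : ℝ) ≤ N := by exact_mod_cast hN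
  have hN0 : (0 : ℝ) < N := lt_of_lt_of_le (lt_of_le_of_lt (by positivity) hN₀) hNN
  rw [Real.dist_eq, sub_zero, abs_div, Nat.abs_cast, div_lt_iff₀ hN0]
  rw [div_lt_iff₀ (by positivity)] at hN₀
  have := hK N
  have := le_abs_self K
  nlinarith

end FE

open scoped Classical in
/-- For distinct odd primes `p₁,…,p_k` and `ε₁,…,ε_k ∈ {0,1}`,
the count of `0 ≤ n < N` with `e_{pᵢ}(n) ≡ εᵢ (mod 2)` for all `i` is asymptotic
to `N/2^k` as `N → ∞`. -/
theorem stmt_2 (k : ℕ) (hk : 0 < k) (p : Fin k → ℕ)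
    (hp : ∀ i, (p i).Prime) (hodd : ∀ i, Odd (p i)) (hpdist : Function.Injective p)
    (ε : Fin k → ℕ) (hε : ∀ i, ε i ≤ 1) :
    Filter.Tendsto
      (fun N : ℕ =>
        (2 : ℝ) ^ k *
          (((Finset.range N).filter
              (fun n => ∀ i, factorialExp (p i) n ≡ ε i [MOD 2])).card : ℝ) / N)
      Filter.atTop (nhds 1) := by
  set C : ℕ → ℝ := fun n => ∑ s ∈ (Finset.univ : Finset (Fin k)).powerset.erase ∅,
    (∏ i ∈ s, (-1 : ℝ) ^ ε i) * ∏ i ∈ s, FE.f (p i) n with hC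
  have hsmall : ∀ δ > 0, FE.Small C δ := by
    intro δ hδ
    set S := (Finset.univ : Finset (Fin k)).powerset.erase ∅ with hS
    have h1 : FE.Small C (∑ s ∈ S, |∏ i ∈ s, (-1 : ℝ) ^ ε i| * (δ / (S.card + 1))) := by
      refine FE.small_sum S fun s hs => FE.small_mul _ ?_
      exact FE.small_prod s p hp hodd hpdist
        (Finset.nonempty_iff_ne_empty.2 (Finset.ne_of_mem_erase hs)) (by positivity)
    refine FE.small_mono h1 ?_
    have : ∀ s ∈ S, |∏ i ∈ s, (-1 : ℝ) ^ ε i| * (δ / (S.card + 1)) = δ / (S.card + 1) := by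
      intro s _
      rw [FE.abs_prod_one _ _ (fun i _ => by simp), one_mul]
    rw [Finset.sum_congr rfl this, Finset.sum_const, nsmul_eq_mul, ← mul_div_assoc,
      div_le_iff₀ (by positivity)]
    nlinarith
  have hlim := (FE.tendsto_of_small hsmall).const_add 1
  rw [add_zero] at hlim
  refine hlim.congr' ?_
  filter_upwards [Filter.eventually_gt_atTop 0] with N hN
  have hN' : (N : ℝ) ≠ 0 := by exact_mod_cast hN.ne'
  have hpt : ∀ n, (2 : ℝ) ^ k * (if ∀ i, factorialExp (p i) n ≡ ε i [MOD 2] then 1 else 0)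
      = 1 + C n := by
    intro n
    have h1 : ∏ i, (1 + (-1 : ℝ) ^ ε i * FE.f (p i) n) = 1 + C n := by
      rw [Finset.prod_one_add, ← Finset.add_sum_erase _ _ (Finset.empty_mem_powerset _)]
      simp [hC, Finset.prod_mul_distrib]
    rw [← h1]
    simp only [FE.ind_eq]
    split_ifs with h
    · simp [h]
    · push Not at h
      obtain ⟨i, hi⟩ := h
      rw [Finset.prod_eq_zero (Finset.mem_univ i) (by rw [if_neg hi])]
      simp
  have hcard : (2 : ℝ) ^ k * (((Finset.range N).filter
      (fun n => ∀ i, factorialExp (p i) n ≡ ε i [MOD 2])).card : ℝ)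
      = N + ∑ n ∈ Finset.range N, C n := by
    rw [Finset.card_filter]
    push_cast
    rw [Finset.mul_sum, Finset.sum_congr rfl (fun n _ => hpt n), Finset.sum_add_distrib]
    simp
  rw [hcard, add_div, div_self hN']
end
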